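/- arXiv:1205.4091 — 10 statements merged into one kernel-verified Lean document; each statement's English description precedes it below -/
import Mathlib

section
/- Let p be a prime number, K a field of characteristic p, and let a : ℕ → K be a sequence satisfying a linear recurrence over K. Then the zero set Z(a) = {n ∈ ℕ : a(n) = 0} is p-automatic, i.e., the collection of subsets of ℕ of the form {n ∈ ℕ : p^i n + j ∈ Z(a)} with i ∈ ℕ and 0 ≤ j < p^i is finite. -/
namespace MvPowerSeries

variable {σ R : Type*} [CommSemiring R]

/-- The Cartier operator extracting the coefficients at the exponents `q • m + e`. -/
noncomputable def cartier (q : ℕ) (e : σ →₀ ℕ) : MvPowerSeries σ R →ₗ[R] MvPowerSeries σ R where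
  toFun f := fun m => coeff (q • m + e) f
  map_add' _ _ := rfl
  map_smul' _ _ := rfl

theorem coeff_cartier (q : ℕ) (e m : σ →₀ ℕ) (f : MvPowerSeries σ R) :
    coeff m (cartier q e f) = coeff (q • m + e) f := rfl

theorem cartier_X_pow_mul {q : ℕ} {e : σ →₀ ℕ} (he : ∀ s, e s < q) (i : σ)
    (f : MvPowerSeries σ R) :
    cartier q e (X i ^ q * f) = X i * cartier q e f := by
  classical
  ext m
  rw [coeff_cartier, X_pow_eq, coeff_monomial_mul, X_def, coeff_monomial_mul]
  have hiff : Finsupp.single i q ≤ q • m + e ↔ Finsupp.single i 1 ≤ m := by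
    rw [Finsupp.single_le_iff, Finsupp.single_le_iff, Finsupp.add_apply, Finsupp.smul_apply,
      smul_eq_mul]
    constructor
    · intro h
      by_contra! h0
      have : m i = 0 := by omega
      rw [this] at h
      have := he i
      omega
    · intro h
      nlinarith
  by_cases h : Finsupp.single i 1 ≤ m
  · rw [if_pos h, if_pos (hiff.2 h), coeff_cartier]
    congr 2
    obtain ⟨m', rfl⟩ := exists_add_of_le h
    rw [smul_add, Finsupp.smul_single, smul_eq_mul, mul_one, add_assoc, add_tsub_cancel_left,
      add_tsub_cancel_left]
  · rw [if_neg h, if_neg (mt hiff.1 h)]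

theorem cartier_coe_pow_mul {p : ℕ} [Fact p.Prime] (i : ℕ) {e : σ →₀ ℕ}
    (he : ∀ s, e s < p ^ i) (g : MvPolynomial σ (ZMod p)) (f : MvPowerSeries σ (ZMod p)) :
    cartier (p ^ i) e ((g : MvPowerSeries σ (ZMod p)) ^ p ^ i * f) = g * cartier (p ^ i) e f := by
  induction g using MvPolynomial.induction_on generalizing f with
  | C a =>
    rw [MvPolynomial.coe_C, ← map_pow, ZMod.pow_card_pow, ← smul_eq_C_mul, ← smul_eq_C_mul,
      map_smul]
  | add g h hg hh =>
    rw [MvPolynomial.coe_add, ← MvPolynomial.coe_add, ← MvPolynomial.coe_pow, add_pow_char_pow,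
      MvPolynomial.coe_add, add_mul, map_add, MvPolynomial.coe_pow, MvPolynomial.coe_pow, hg, hh,
      MvPolynomial.coe_add, add_mul]
  | mul_X g s hg =>
    rw [MvPolynomial.coe_mul, mul_pow, mul_assoc, hg, MvPolynomial.coe_X, cartier_X_pow_mul he,
      mul_assoc]

theorem finite_setOf_coeff_eq_zero_of_lt_degree [Finite σ] [Finite R] (D : ℕ) :
    {f : MvPowerSeries σ R | ∀ m, D < m.degree → coeff m f = 0}.Finite := by
  have hfin : {m : σ →₀ ℕ | m.degree ≤ D}.Finite := Finsupp.finite_of_degree_le D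
  have := hfin.to_subtype
  refine Set.Finite.of_injOn (f := fun f (m : {m : σ →₀ ℕ | m.degree ≤ D}) => coeff m.1 f)
    (t := Set.univ) (fun _ _ => Set.mem_univ _) ?_ Set.finite_univ
  intro f hf g hg h
  ext m
  by_cases hm : m.degree ≤ D
  · exact congrFun h ⟨m, hm⟩
  · rw [hf m (by omega), hg m (by omega)]

theorem finite_cartier_of_mul_eq {p : ℕ} [Fact p.Prime] [Finite σ]
    {f : MvPowerSeries σ (ZMod p)} {P Q : MvPolynomial σ (ZMod p)} (hQ : Q ≠ 0)
    (hf : f * Q = P) :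
    {g | ∃ i e, (∀ s, e s < p ^ i) ∧ g = cartier (p ^ i) e f}.Finite := by
  set D := max P.totalDegree Q.totalDegree
  refine Set.Finite.of_injOn (f := fun g => g * (Q : MvPowerSeries σ (ZMod p))) ?_ ?_
    (finite_setOf_coeff_eq_zero_of_lt_degree (σ := σ) (R := ZMod p) D)
  · rintro _ ⟨i, e, he, rfl⟩ m hm
    have hq : 0 < p ^ i := pow_pos (Fact.out : p.Prime).pos i
    set q := p ^ i with hqdef
    have key : cartier q e f * (Q : MvPowerSeries σ (ZMod p)) =
        cartier q e ((P * Q ^ (q - 1) : MvPolynomial σ (ZMod p)) : MvPowerSeries σ (ZMod p)) := by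
      rw [MvPolynomial.coe_mul, ← hf, MvPolynomial.coe_pow, mul_assoc, ← pow_succ',
        Nat.sub_add_cancel hq, mul_comm, mul_comm f, cartier_coe_pow_mul i he]
    simp only
    rw [key, coeff_cartier, MvPolynomial.coeff_coe]
    apply MvPolynomial.coeff_eq_zero_of_totalDegree_lt
    have h1 : (P * Q ^ (q - 1)).totalDegree ≤ q * D := by
      refine (MvPolynomial.totalDegree_mul _ _).trans ?_
      have h2 := MvPolynomial.totalDegree_pow Q (q - 1)
      have h3 : (q - 1) * Q.totalDegree ≤ (q - 1) * D := Nat.mul_le_mul_left _ (le_max_right _ _)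
      have h4 : P.totalDegree ≤ D := le_max_left _ _
      obtain ⟨r, hr⟩ : ∃ r, q = r + 1 := ⟨q - 1, by omega⟩
      rw [hr, Nat.add_sub_cancel] at h2 h3
      rw [hr, Nat.add_sub_cancel]
      nlinarith
    have h5 : q * D < q * m.degree := Nat.mul_lt_mul_of_pos_left hm hq
    have h6 : (q • m + e).degree = q * m.degree + e.degree := by
      rw [map_add, map_nsmul, smul_eq_mul]
    change _ < (q • m + e).degree
    omega
  · intro g _ h _ hgh
    exact mul_right_cancel₀ (fun h0 => hQ (MvPolynomial.coe_eq_zero_iff.1 h0)) hgh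

/-- The coefficient of `X 0 ^ n` in a power series, as a power series in the other variables. -/
noncomputable def slice {s : ℕ} (n : ℕ) :
    MvPowerSeries (Fin (s + 1)) R →ₗ[R] MvPowerSeries (Fin s) R where
  toFun f := fun m => coeff (m.cons n) f
  map_add' _ _ := rfl
  map_smul' _ _ := rfl

variable {s : ℕ}

theorem coeff_slice (n : ℕ) (m : Fin s →₀ ℕ) (f : MvPowerSeries (Fin (s + 1)) R) :
    coeff m (slice n f) = coeff (m.cons n) f := rfl

theorem ext_slice {f g : MvPowerSeries (Fin (s + 1)) R} (h : ∀ n, slice n f = slice n g) :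
    f = g := by
  ext m
  rw [← m.cons_tail, ← coeff_slice, ← coeff_slice, h]

theorem exists_slice_eq (b : ℕ → MvPowerSeries (Fin s) R) :
    ∃ f : MvPowerSeries (Fin (s + 1)) R, ∀ n, slice n f = b n := by
  refine ⟨(fun m => coeff m.tail (b (m 0)) : (Fin (s + 1) →₀ ℕ) → R), fun n => ?_⟩
  ext m
  change coeff (m.cons n).tail (b (m.cons n 0)) = _
  rw [Finsupp.tail_cons, Finsupp.cons_zero]

theorem slice_X_succ_mul (n : ℕ) (i : Fin s) (f : MvPowerSeries (Fin (s + 1)) R) :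
    slice n (X i.succ * f) = X i * slice n f := by
  classical
  ext m
  rw [coeff_slice, X_def, coeff_monomial_mul, X_def, coeff_monomial_mul]
  simp only [Finsupp.single_le_iff, Finsupp.cons_succ, coeff_slice]
  have : m.cons n - Finsupp.single i.succ 1 = (m - Finsupp.single i 1).cons n := by
    ext j
    cases j using Fin.cases <;> simp [Finsupp.single_apply]
  rw [this]

theorem slice_rename_mul (n : ℕ) (g : MvPolynomial (Fin s) R)
    (f : MvPowerSeries (Fin (s + 1)) R) :
    slice n (((MvPolynomial.rename Fin.succ g : MvPolynomial (Fin (s + 1)) R) : MvPowerSeries _ R) *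
      f : MvPowerSeries (Fin (s + 1)) R) = (g : MvPowerSeries (Fin s) R) * slice n f := by
  induction g using MvPolynomial.induction_on generalizing f with
  | C a =>
    rw [MvPolynomial.rename_C, MvPolynomial.coe_C, MvPolynomial.coe_C, ← smul_eq_C_mul,
      ← smul_eq_C_mul, map_smul]
  | add g h hg hh => simp only [map_add, MvPolynomial.coe_add, add_mul, hg, hh]
  | mul_X g i hg =>
    rw [map_mul (MvPolynomial.rename Fin.succ), MvPolynomial.rename_X, MvPolynomial.coe_mul,
      MvPolynomial.coe_mul, mul_assoc, hg,
      MvPolynomial.coe_X, MvPolynomial.coe_X, slice_X_succ_mul, mul_assoc]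

theorem slice_X_zero_pow_mul (n k : ℕ) (f : MvPowerSeries (Fin (s + 1)) R) :
    slice n (X 0 ^ k * f) = if k ≤ n then slice (n - k) f else 0 := by
  classical
  ext m
  rw [coeff_slice, X_pow_eq, coeff_monomial_mul]
  simp only [Finsupp.single_le_iff, Finsupp.cons_zero]
  split_ifs with h
  · rw [coeff_slice, one_mul]
    congr 2
    ext j
    cases j using Fin.cases <;> simp
  · rw [map_zero]

theorem slice_one (n : ℕ) :
    slice n (1 : MvPowerSeries (Fin (s + 1)) R) = if n = 0 then 1 else 0 := by
  classical
  ext m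
  rw [coeff_slice, coeff_one]
  by_cases hn : n = 0
  · subst hn
    have : m.cons 0 = 0 ↔ m = 0 := by
      rw [← Finsupp.cons_zero_zero]
      exact (Finsupp.cons_right_injective 0).eq_iff
    simp [coeff_one, this]
  · rw [if_neg hn, if_neg, map_zero]
    exact Finsupp.cons_ne_zero_of_left hn

theorem exists_mul_eq_of_recurrence [Nontrivial R] {χ : Polynomial (MvPolynomial (Fin s) R)}
    (hχ : χ.Monic) {b : ℕ → MvPolynomial (Fin s) R} {N : ℕ}
    (hb : ∀ n, N ≤ n → ∑ k ∈ Finset.range (χ.natDegree + 1), χ.coeff k * b (n + k) = 0)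
    {f : MvPowerSeries (Fin (s + 1)) R} (hf : ∀ n, slice n f = b n) :
    ∃ P Q : MvPolynomial (Fin (s + 1)) R, Q ≠ 0 ∧ (Q : MvPowerSeries (Fin (s + 1)) R) * f = P := by
  set d := χ.natDegree
  let Q : MvPolynomial (Fin (s + 1)) R := ∑ k ∈ Finset.range (d + 1),
    MvPolynomial.X 0 ^ (d - k) * MvPolynomial.rename Fin.succ (χ.coeff k)
  let h : ℕ → MvPolynomial (Fin s) R := fun n => ∑ k ∈ Finset.range (d + 1),
    if d - k ≤ n then χ.coeff k * b (n - (d - k)) else 0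
  let P : MvPolynomial (Fin (s + 1)) R := ∑ l ∈ Finset.range (N + d),
    MvPolynomial.X 0 ^ l * MvPolynomial.rename Fin.succ (h l)
  have coe_sum {τ : Type} {t : Finset ℕ} (u : ℕ → MvPolynomial τ R) :
      ((∑ k ∈ t, u k : MvPolynomial τ R) : MvPowerSeries τ R) =
        ∑ k ∈ t, (u k : MvPowerSeries τ R) :=
    map_sum (MvPolynomial.coeToMvPowerSeries.ringHom (σ := τ) (R := R)) u t
  have hQ (n : ℕ) (g : MvPowerSeries (Fin (s + 1)) R) :
      slice n ((Q : MvPowerSeries (Fin (s + 1)) R) * g) =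
      ∑ k ∈ Finset.range (d + 1),
        if d - k ≤ n then (χ.coeff k : MvPowerSeries (Fin s) R) * slice (n - (d - k)) g else 0 := by
    simp only [Q, coe_sum, Finset.sum_mul, map_sum, MvPolynomial.coe_mul, MvPolynomial.coe_pow,
      MvPolynomial.coe_X, mul_assoc, slice_X_zero_pow_mul, slice_rename_mul]
  have hP (n : ℕ) : slice n (P : MvPowerSeries (Fin (s + 1)) R) =
      if n < N + d then (h n : MvPowerSeries (Fin s) R) else 0 := by
    rw [← mul_one (P : MvPowerSeries (Fin (s + 1)) R)]
    simp only [P, coe_sum, Finset.sum_mul, map_sum, MvPolynomial.coe_mul, MvPolynomial.coe_pow,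
      MvPolynomial.coe_X, mul_assoc, slice_X_zero_pow_mul, slice_rename_mul, slice_one]
    split_ifs with hn
    · rw [Finset.sum_eq_single n]
      · simp
      · intro l _ hl
        split_ifs
        · omega
        · rw [mul_zero]
        · rfl
      · intro h
        exact absurd (Finset.mem_range.2 hn) h
    · refine Finset.sum_eq_zero fun l hl => ?_
      have := Finset.mem_range.1 hl
      rw [if_pos (by omega), if_neg (by omega), mul_zero]
  refine ⟨P, Q, fun h0 => ?_, ext_slice fun n => ?_⟩
  · have h1 := hQ 0 1
    rw [h0, MvPolynomial.coe_zero, zero_mul, map_zero, Finset.sum_eq_single d] at h1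
    · simp [slice_one, d, hχ.coeff_natDegree] at h1
    · intro k hk hkd
      rw [if_neg]
      have := Finset.mem_range.1 hk
      omega
    · simp
  · rw [hQ, hP]
    have hh : (∑ k ∈ Finset.range (d + 1), if d - k ≤ n then
        (χ.coeff k : MvPowerSeries (Fin s) R) * slice (n - (d - k)) f else 0) =
        (h n : MvPowerSeries (Fin s) R) := by
      simp only [h, coe_sum, hf]
      refine Finset.sum_congr rfl fun k _ => ?_
      split_ifs
      · rw [MvPolynomial.coe_mul]
      · rw [MvPolynomial.coe_zero]
    rw [hh]
    split_ifs with hn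
    · rfl
    · have : h n = 0 := by
        rw [← hb (n - d) (by omega)]
        refine Finset.sum_congr rfl fun k hk => ?_
        have := Finset.mem_range.1 hk
        rw [if_pos (by omega)]
        congr 2
        omega
      rw [this, MvPolynomial.coe_zero]

end MvPowerSeries

theorem LinearRecurrence.tupleSucc_window {R : Type*} [CommSemiring R] (E : LinearRecurrence R)
    {a : ℕ → R} {n : ℕ} (h : a (n + E.order) = ∑ i, E.coeffs i * a (n + i)) :
    E.tupleSucc (fun i => a (n + i)) = fun i : Fin E.order => a (n + 1 + i) := by
  ext i
  change (if h : (i : ℕ) + 1 < E.order then a (n + (i + 1)) else ∑ j, E.coeffs j * a (n + j)) = _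
  split_ifs with hi
  · congr 1
    ring
  · rw [← h]
    congr 1
    omega

/-- A sequence satisfying a linear recurrence over a ring finite over `A` satisfies a monic one
over `A`. -/
theorem LinearRecurrence.exists_monic_of_finite (A : Type*) {R : Type*} [CommRing A] [CommRing R]
    [Algebra A R] [Module.Finite A R] (E : LinearRecurrence R) (hE : 0 < E.order)
    {a : ℕ → R} {N : ℕ} (ha : ∀ n, N ≤ n → a (n + E.order) = ∑ i, E.coeffs i * a (n + i)) :
    ∃ χ : Polynomial A, χ.Monic ∧ ∀ n, N ≤ n →
      ∑ k ∈ Finset.range (χ.natDegree + 1), χ.coeff k • a (n + k) = 0 := by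
  let M : Module.End A (Fin E.order → R) := E.tupleSucc.restrictScalars A
  obtain ⟨χ, hχ, hM⟩ := LinearMap.exists_monic_and_aeval_eq_zero A M
  refine ⟨χ, hχ, fun n hn => ?_⟩
  have hpow (k : ℕ) : (M ^ k) (fun i => a (n + i)) =
      fun i : Fin E.order => a (n + k + i) := by
    induction k with
    | zero => rfl
    | succ k ih =>
      rw [pow_succ', Module.End.mul_apply, ih]
      exact E.tupleSucc_window (ha _ (by omega))
  have h := congrFun (LinearMap.congr_fun hM fun i => a (n + i)) ⟨0, hE⟩
  rw [Polynomial.aeval_eq_sum_range, LinearMap.sum_apply, Finset.sum_apply] at h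
  simpa [hpow] using h

theorem Module.Finite.exists_separating_linearMap (A R : Type*) [CommRing A] [IsDomain A]
    [AddCommGroup R] [Module A R] [Module.Finite A R] [Module.IsTorsionFree A R] :
    ∃ (r : ℕ) (φ : Fin r → R →ₗ[A] A), ∀ x, (∀ i, φ i x = 0) → x = 0 := by
  let S := nonZeroDivisors A
  let F := FractionRing A
  let V := LocalizedModule S R
  let ι : R →ₗ[A] V := LocalizedModule.mkLinearMap S R
  have : Module.Finite F V := Module.Finite.of_isLocalizedModule S ι
  let B := Module.finBasis F V
  let κ (i : Fin (Module.finrank F V)) : R →ₗ[A] F := (B.coord i).restrictScalars A ∘ₗ ι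
  have hκ (i) : ∃ d ∈ S, ∃ φ : R →ₗ[A] A, ∀ x, algebraMap A F (φ x) = d • κ i x := by
    obtain ⟨d, hd, h⟩ := FractionalIdeal.isFractional_of_fg (S := S)
      (Module.Finite.iff_fg.1 (Module.Finite.range (κ i)))
    have hinj : Function.Injective (Algebra.linearMap A F) := IsFractionRing.injective A F
    refine ⟨d, hd, (LinearEquiv.ofInjective _ hinj).symm.toLinearMap ∘ₗ
      (d • κ i).codRestrict (LinearMap.range (Algebra.linearMap A F)) (fun x => ?_), fun x => ?_⟩
    · exact h _ ⟨x, rfl⟩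
    · exact congrArg Subtype.val ((LinearEquiv.ofInjective _ hinj).apply_symm_apply _)
  choose d hd φ hφ using hκ
  refine ⟨_, φ, fun x hx => ?_⟩
  have hι : ι x = 0 := by
    refine B.ext_elem fun i => ?_
    have h := hφ i x
    rw [hx, map_zero, eq_comm, smul_eq_zero_iff_right (nonZeroDivisors.ne_zero (hd i))] at h
    rw [map_zero]
    exact h
  obtain ⟨c, hc⟩ := (IsLocalizedModule.eq_zero_iff S ι).1 hι
  exact (smul_eq_zero_iff_right (nonZeroDivisors.ne_zero c.2)).1 hc

/-- The `p`-kernel of a set of natural numbers. -/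
def natKernel (p : ℕ) (S : Set ℕ) : Set (Set ℕ) :=
  {T | ∃ i j : ℕ, j < p ^ i ∧ T = {n | p ^ i * n + j ∈ S}}

theorem finite_natKernel_iInter {p : ℕ} {ι : Type*} [Finite ι] {S : ι → Set ℕ}
    (h : ∀ l, (natKernel p (S l)).Finite) : (natKernel p (⋂ l, S l)).Finite := by
  refine ((Set.Finite.pi' h).image fun T => ⋂ l, T l).subset ?_
  rintro _ ⟨i, j, hj, rfl⟩
  refine ⟨fun l => {n | p ^ i * n + j ∈ S l}, fun l => ⟨i, j, hj, rfl⟩, ?_⟩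
  ext n
  simp

theorem finite_natKernel_mvPolynomial_recurrence {p s : ℕ} [Fact p.Prime]
    {χ : Polynomial (MvPolynomial (Fin s) (ZMod p))} (hχ : χ.Monic)
    {b : ℕ → MvPolynomial (Fin s) (ZMod p)} {N : ℕ}
    (hb : ∀ n, N ≤ n → ∑ k ∈ Finset.range (χ.natDegree + 1), χ.coeff k * b (n + k) = 0) :
    (natKernel p {n | b n = 0}).Finite := by
  obtain ⟨f, hf⟩ := MvPowerSeries.exists_slice_eq
    fun n => (b n : MvPowerSeries (Fin s) (ZMod p))
  obtain ⟨P, Q, hQ, hPQ⟩ := MvPowerSeries.exists_mul_eq_of_recurrence hχ hb hf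
  rw [mul_comm] at hPQ
  refine ((MvPowerSeries.finite_cartier_of_mul_eq hQ hPQ).finite_subsets.image
    fun H => {n | ∀ g ∈ H, MvPowerSeries.slice n g = 0}).subset ?_
  rintro _ ⟨i, j, hj, rfl⟩
  refine ⟨{g | ∃ e, (∀ t, e t < p ^ i) ∧ e 0 = j ∧ g = MvPowerSeries.cartier (p ^ i) e f},
    fun g ⟨e, he, _, hg⟩ => ⟨i, e, he, hg⟩, ?_⟩
  have hq : 0 < p ^ i := pow_pos (Fact.out : p.Prime).pos i
  have hcoeff (n : ℕ) (m : Fin s →₀ ℕ) :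
      (b n).coeff m = MvPowerSeries.coeff (m.cons n) f := by
    rw [← MvPowerSeries.coeff_slice, hf, MvPolynomial.coeff_coe]
  ext n
  simp only [Set.mem_ofPred_eq]
  constructor
  · intro h
    ext m
    let e : Fin s →₀ ℕ := m.mapRange (· % p ^ i) (Nat.zero_mod _)
    let m' : Fin s →₀ ℕ := m.mapRange (· / p ^ i) (Nat.zero_div _)
    have h1 := congrArg (MvPowerSeries.coeff m') (h _ ⟨e.cons j, fun t => ?_, e.cons_zero j, rfl⟩)
    · rw [MvPowerSeries.coeff_slice, MvPowerSeries.coeff_cartier, map_zero] at h1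
      rw [hcoeff, MvPolynomial.coeff_zero, ← h1]
      congr 2
      ext t
      cases t using Fin.cases <;> simp [e, m', Nat.div_add_mod]
    · cases t using Fin.cases
      · simpa using hj
      · simpa [e] using Nat.mod_lt _ hq
  · rintro h _ ⟨e, he, rfl, rfl⟩
    ext m
    rw [MvPowerSeries.coeff_slice, MvPowerSeries.coeff_cartier, map_zero]
    have h1 := hcoeff (p ^ i * n + e 0) (p ^ i • m + e.tail)
    rw [h, MvPolynomial.coeff_zero] at h1
    rw [h1]
    congr 2
    ext t
    cases t using Fin.cases <;> simp [Finsupp.tail_apply]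

/-- The zero set of a linear recurrence in a finitely generated domain of characteristic `p` has
finite `p`-kernel. -/
theorem finite_natKernel_of_finiteType {p : ℕ} [Fact p.Prime] {R : Type*} [CommRing R] [IsDomain R]
    [Algebra (ZMod p) R] [Algebra.FiniteType (ZMod p) R] (E : LinearRecurrence R)
    (hE : 0 < E.order) {a : ℕ → R} {N : ℕ}
    (ha : ∀ n, N ≤ n → a (n + E.order) = ∑ i, E.coeffs i * a (n + i)) :
    (natKernel p {n | a n = 0}).Finite := by
  obtain ⟨s, g, hg, hfin⟩ := exists_finite_inj_algHom_of_fg (ZMod p) R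
  let A := MvPolynomial (Fin s) (ZMod p)
  algebraize [g.toRingHom]
  have : Module.Finite A R := hfin
  have : FaithfulSMul A R := (faithfulSMul_iff_algebraMap_injective A R).2 hg
  obtain ⟨χ, hχ, hrec⟩ := E.exists_monic_of_finite A hE ha
  obtain ⟨r, φ, hφ⟩ := Module.Finite.exists_separating_linearMap A R
  have hzero : {n | a n = 0} = ⋂ l, {n | φ l (a n) = 0} := by
    ext n
    simp only [Set.mem_ofPred_eq, Set.mem_iInter]
    exact ⟨fun h l => by rw [h, map_zero], hφ _⟩
  rw [hzero]
  refine finite_natKernel_iInter fun l =>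
    finite_natKernel_mvPolynomial_recurrence (N := N) hχ fun n hn => ?_
  have h := congrArg (φ l) (hrec n hn)
  simpa only [map_sum, map_smul, map_zero, smul_eq_mul] using h

/-- Derksen: the zero set of a linear recurrence sequence over a
field of characteristic `p` is `p`-automatic, i.e. its `p`-kernel is finite. -/
theorem zero_set_of_linear_recurrence_automatic
    (p : ℕ) (hp : p.Prime) (K : Type*) [Field K] [CharP K p]
    (a : ℕ → K)
    (hrec : ∃ m : ℕ, 0 < m ∧ ∃ c : Fin m → K, ∃ N : ℕ,
        ∀ n, N ≤ n → a (n + m) = ∑ i : Fin m, c i * a (n + i)) :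
    Set.Finite { T : Set ℕ | ∃ i j : ℕ, j < p ^ i ∧
      T = { n : ℕ | p ^ i * n + j ∈ { n' : ℕ | a n' = 0 } } } := by
  have : Fact p.Prime := ⟨hp⟩
  obtain ⟨m, hm, c, N, h⟩ := hrec
  let _ := ZMod.algebra K p
  let S : Set K := Set.range c ∪ a '' Set.Iio (N + m)
  have hS : S.Finite := (Set.finite_range c).union ((Set.finite_Iio _).image a)
  let R := Algebra.adjoin (ZMod p) S
  have : Algebra.FiniteType (ZMod p) R :=
    R.fg_iff_finiteType.1 (Subalgebra.fg_def.2 ⟨S, hS, rfl⟩)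
  have hc (i) : c i ∈ R := Algebra.subset_adjoin (Or.inl ⟨i, rfl⟩)
  have ha (n) : a n ∈ R := by
    induction n using Nat.strong_induction_on with
    | _ n ih =>
      by_cases hn : n < N + m
      · exact Algebra.subset_adjoin (Or.inr ⟨n, hn, rfl⟩)
      · obtain ⟨k, rfl⟩ : ∃ k, n = k + m := ⟨n - m, by omega⟩
        rw [h k (by omega)]
        exact sum_mem fun i _ => mul_mem (hc i) (ih _ (by omega))
  have hfin := finite_natKernel_of_finiteType (p := p) (R := R) ⟨m, fun i => ⟨c i, hc i⟩⟩ hm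
    (a := fun n => ⟨a n, ha n⟩) (N := N) fun n hn => Subtype.ext (by simpa using h n hn)
  have hset : {n | (⟨a n, ha n⟩ : R) = 0} = {n | a n = 0} := by
    ext n
    simp [Subtype.ext_iff]
  rw [hset] at hfin
  exact hfin
end

section
/- Let p be a prime number, K a field of characteristic p, d a positive integer, and let a_1,…,a_d : ℕ → K be sequences each satisfying a linear recurrence over K. Then the set Z(a_1,…,a_d) = {(n_1,…,n_d) ∈ ℕ^d : a_1(n_1) + ⋯ + a_d(n_d) = 0} is p-automatic, i.e., its p-kernel is finite. -/
section MonomialSpan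

variable {p : ℕ} {F ι : Type*} [Field F] [Algebra (ZMod p) F] [Fintype ι]

/-- The `𝔽_p`-span of the monomials in `t` whose exponents are all at most `D`. -/
def monomialSpan (p : ℕ) {F ι : Type*} [Field F] [Algebra (ZMod p) F] [Fintype ι]
    (t : ι → F) (D : ℕ) : Submodule (ZMod p) F :=
  Submodule.span (ZMod p) {x | ∃ m : ι → ℕ, (∀ l, m l ≤ D) ∧ x = ∏ l, t l ^ m l}

lemma monomialSpan_mono (t : ι → F) {C D : ℕ} (h : C ≤ D) :
    monomialSpan p t C ≤ monomialSpan p t D :=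
  Submodule.span_mono fun _ ⟨m, hm, hx⟩ => ⟨m, fun l => (hm l).trans h, hx⟩

lemma mul_mem_monomialSpan {t : ι → F} {C D : ℕ} {x y : F} (hx : x ∈ monomialSpan p t C)
    (hy : y ∈ monomialSpan p t D) : x * y ∈ monomialSpan p t (C + D) := by
  have h := Submodule.mul_mem_mul hx hy
  rw [monomialSpan, monomialSpan, Submodule.span_mul_span] at h
  refine Submodule.span_mono ?_ h
  rintro _ ⟨_, ⟨m, hm, rfl⟩, _, ⟨n, hn, rfl⟩, rfl⟩
  exact ⟨fun l => m l + n l, fun l => add_le_add (hm l) (hn l), by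
    simp [pow_add, Finset.prod_mul_distrib]⟩

lemma finite_monomialSpan [Fact p.Prime] (t : ι → F) (D : ℕ) :
    (monomialSpan p t D : Set F).Finite := by
  have hfin : {x | ∃ m : ι → ℕ, (∀ l, m l ≤ D) ∧ x = ∏ l, t l ^ m l}.Finite := by
    refine ((Set.Finite.pi' fun _ : ι => Set.finite_Iic D).image
      fun m => ∏ l, t l ^ m l).subset ?_
    rintro _ ⟨m, hm, rfl⟩
    exact ⟨m, hm, rfl⟩
  have : Module.Finite (ZMod p) (monomialSpan p t D) := Module.Finite.span_of_finite _ hfin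
  exact Set.finite_coe_iff.mp (Module.finite_of_finite (ZMod p))

lemma exists_mem_monomialSpan {t : ι → F} {x : F} (hx : x ∈ Subring.closure (Set.range t)) :
    ∃ D, x ∈ monomialSpan p t D := by
  classical
  induction hx using Subring.closure_induction with
  | mem x hx =>
    obtain ⟨l, rfl⟩ := hx
    refine ⟨1, Submodule.subset_span ⟨Pi.single l 1, fun k => ?_, ?_⟩⟩
    · rw [Pi.single_apply]; split_ifs <;> simp
    · rw [Finset.prod_eq_single l] <;> simp +contextual
  | zero => exact ⟨0, zero_mem _⟩
  | one => exact ⟨0, Submodule.subset_span ⟨0, by simp, by simp⟩⟩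
  | add x y _ _ hx hy =>
    obtain ⟨C, hC⟩ := hx
    obtain ⟨D, hD⟩ := hy
    exact ⟨max C D, add_mem (monomialSpan_mono t (le_max_left _ _) hC)
      (monomialSpan_mono t (le_max_right _ _) hD)⟩
  | neg x _ hx =>
    obtain ⟨C, hC⟩ := hx
    exact ⟨C, neg_mem hC⟩
  | mul x y _ _ hx hy =>
    obtain ⟨C, hC⟩ := hx
    obtain ⟨D, hD⟩ := hy
    exact ⟨C + D, mul_mem_monomialSpan hC hD⟩

lemma exists_subset_monomialSpan {t : ι → F} {A : Set F} (hA : A.Finite)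
    (h : A ⊆ Subring.closure (Set.range t)) : ∃ D, A ⊆ monomialSpan p t D := by
  induction A, hA using Set.Finite.induction_on with
  | empty => exact ⟨0, Set.empty_subset _⟩
  | insert _ _ ih =>
    rw [Set.insert_subset_iff] at h
    obtain ⟨C, hC⟩ := ih h.2
    obtain ⟨D, hD⟩ := exists_mem_monomialSpan (p := p) h.1
    exact ⟨max C D, Set.insert_subset (monomialSpan_mono t (le_max_right _ _) hD)
      (hC.trans (monomialSpan_mono t (le_max_left _ _)))⟩

lemma exists_pow_decomposition [DecidableEq ι] [Fact p.Prime] [CharP F p] {t : ι → F} {D : ℕ} {y : F}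
    (hy : y ∈ monomialSpan p t D) :
    ∃ z : (ι → Fin p) → F, (∀ h, z h ∈ monomialSpan p t (D / p)) ∧
      y = ∑ h, z h ^ p * ∏ l, t l ^ (h l : ℕ) := by
  have hp : 0 < p := (Fact.out : p.Prime).pos
  induction hy using Submodule.span_induction with
  | mem x hx =>
    obtain ⟨m, hm, rfl⟩ := hx
    let r : ι → Fin p := fun l => ⟨m l % p, Nat.mod_lt _ hp⟩
    refine ⟨Pi.single r (∏ l, t l ^ (m l / p)), fun h => ?_, ?_⟩
    · rw [Pi.single_apply]
      split_ifs
      · exact Submodule.subset_span ⟨_, fun l => Nat.div_le_div_right (hm l), rfl⟩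
      · exact zero_mem _
    · rw [Finset.sum_eq_single r]
      · rw [Pi.single_eq_same, ← Finset.prod_pow, ← Finset.prod_mul_distrib]
        refine Finset.prod_congr rfl fun l _ => ?_
        rw [← pow_mul, ← pow_add, Nat.div_add_mod']
      · intro h _ hne
        rw [Pi.single_eq_of_ne hne, zero_pow hp.ne', zero_mul]
      · simp
  | zero => exact ⟨0, fun _ => zero_mem _, by simp [zero_pow hp.ne']⟩
  | add x y _ _ hx hy =>
    obtain ⟨z, hz, hxz⟩ := hx
    obtain ⟨z', hz', hyz⟩ := hy
    refine ⟨z + z', fun h => add_mem (hz h) (hz' h), ?_⟩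
    simp [hxz, hyz, add_pow_char, add_mul, Finset.sum_add_distrib]
  | smul c x _ hx =>
    obtain ⟨z, hz, hxz⟩ := hx
    refine ⟨c • z, fun h => Submodule.smul_mem _ _ (hz h), ?_⟩
    simp [hxz, smul_pow, ZMod.pow_card, Finset.smul_sum]

end MonomialSpan

lemma exists_common_denominator {F : Type*} [Field F] {X : Set F}
    (hX : Subfield.closure X = ⊤) {A : Set F} (hA : A.Finite) :
    ∃ q ≠ 0, ∀ x ∈ A, q * x ∈ Subring.closure X := by
  suffices ∃ q ∈ Subring.closure X, q ≠ 0 ∧ ∀ x ∈ A, q * x ∈ Subring.closure X by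
    obtain ⟨q, -, h⟩ := this
    exact ⟨q, h⟩
  induction A, hA using Set.Finite.induction_on with
  | empty => exact ⟨1, one_mem _, one_ne_zero, by simp⟩
  | @insert a A _ _ ih =>
    obtain ⟨q, hq, hq0, h⟩ := ih
    obtain ⟨y, hy, z, hz, rfl⟩ := Subfield.mem_closure_iff.mp (hX ▸ Subfield.mem_top a)
    by_cases hz0 : z = 0
    · refine ⟨q, hq, hq0, ?_⟩
      rintro x (rfl | hx)
      · simp [hz0]
      · exact h x hx
    · refine ⟨z * q, mul_mem hz hq, mul_ne_zero hz0 hq0, ?_⟩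
      rintro x (rfl | hx)
      · rw [show z * q * (y / z) = q * y by field_simp]
        exact mul_mem hq hy
      · rw [mul_assoc]
        exact mul_mem hz (h x hx)

/-- The vanishing of `∑ τ_h g_h ^ p` is equivalent to finitely many linear equations in `g`, with
coefficients in a given ring whose fraction field is everything. -/
lemma exists_linear_equations {F : Type*} [Field F] (p : ℕ) [Fact p.Prime] [CharP F p]
    {X : Set F} (hX : Subfield.closure X = ⊤) {H : Type*} [Fintype H] (τ : H → F) :
    ∃ (m : ℕ) (c : Fin m → H → F), (∀ b h, c b h ∈ Subring.closure X) ∧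
      ∀ g : H → F, ∑ h, g h ^ p * τ h = 0 ↔ ∀ b, ∑ h, c b h * g h = 0 := by
  classical
  have hp : p ≠ 0 := (Fact.out : p.Prime).ne_zero
  let N : Submodule F (H → F) :=
    { carrier := {g | ∑ h, g h ^ p * τ h = 0}
      zero_mem' := by simp [zero_pow hp]
      add_mem' := fun {f g} hf hg => by
        simp only [Set.mem_ofPred_eq] at hf hg ⊢
        simp [add_pow_char, add_mul, Finset.sum_add_distrib, hf, hg]
      smul_mem' := fun a g hg => by
        simp only [Set.mem_ofPred_eq] at hg ⊢
        simp [mul_pow, mul_assoc, ← Finset.mul_sum, hg] }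
  let L : (H → F) →ₗ[F] (Fin (Module.finrank F ((H → F) ⧸ N)) → F) :=
    (Module.finBasis F ((H → F) ⧸ N)).equivFun.toLinearMap ∘ₗ N.mkQ
  have hL : ∀ g, L g = 0 ↔ ∑ h, g h ^ p * τ h = 0 := fun g => by
    simp only [L, LinearMap.comp_apply, LinearEquiv.coe_coe, LinearEquiv.map_eq_zero_iff,
      Submodule.mkQ_apply, Submodule.Quotient.mk_eq_zero]
    rfl
  have key : ∀ g b, L g b = ∑ h, L (Pi.single h 1) b * g h := fun g b => by
    rw [LinearMap.pi_apply_eq_sum_univ L g, Finset.sum_apply]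
    refine Finset.sum_congr rfl fun h _ => ?_
    have hs : (Pi.single h 1 : H → F) = fun k => if h = k then 1 else 0 := by
      ext k
      simp [Pi.single_apply, eq_comm]
    rw [Pi.smul_apply, smul_eq_mul, mul_comm, hs]
  obtain ⟨q, hq0, hq⟩ := exists_common_denominator hX
    (Set.finite_range fun x : _ × H => L (Pi.single x.2 1) x.1)
  refine ⟨_, fun b h => q * L (Pi.single h 1) b, fun b h => hq _ ⟨(b, h), rfl⟩, fun g => ?_⟩
  simp_rw [mul_assoc, ← Finset.mul_sum, ← key, mul_eq_zero, hq0, false_or]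
  rw [← hL, funext_iff]
  rfl

/-- In a finitely generated field of characteristic `p`, a finite set `A` is contained in a finite
additive group `W` such that equations `∑ y_k e_k ^ p = 0` with coefficients in `A * W` reduce to
linear equations in `e` with coefficients in `W`. -/
lemma exists_finite_stable_submodule {F : Type*} [Field F] (p : ℕ) [Fact p.Prime]
    [CharP F p] [Algebra (ZMod p) F] {X : Set F} (hX : X.Finite) (hX' : Subfield.closure X = ⊤)
    {A : Set F} (hA : A.Finite) :
    ∃ (W Y : Submodule (ZMod p) F) (m : ℕ) (π : Fin m → F → F),
      (W : Set F).Finite ∧ A ⊆ W ∧ (∀ w ∈ W, ∀ x ∈ A, w * x ∈ Y) ∧ (∀ b, ∀ y ∈ Y, π b y ∈ W) ∧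
      ∀ (J : Type) [Fintype J] (y e : J → F), (∀ k, y k ∈ Y) →
        (∑ k, y k * e k ^ p = 0 ↔ ∀ b, ∑ k, π b (y k) * e k = 0) := by
  classical
  obtain ⟨ι, _, t, ht⟩ : ∃ (ι : Type _) (_ : Fintype ι) (t : ι → F), Set.range t = X ∪ A :=
    ⟨_, (hX.union hA).fintype, Subtype.val, Subtype.range_coe⟩
  have htop : Subfield.closure (Set.range t) = ⊤ := by
    rw [ht, eq_top_iff, ← hX']
    exact Subfield.closure_mono Set.subset_union_left
  have hAt : A ⊆ Subring.closure (Set.range t) := by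
    rw [ht]
    exact Set.subset_union_right.trans Subring.subset_closure
  obtain ⟨m, c, hc, hceq⟩ := exists_linear_equations p htop
    fun h : ι → Fin p => ∏ l, t l ^ (h l : ℕ)
  obtain ⟨C, hC⟩ := exists_subset_monomialSpan (p := p) hA hAt
  obtain ⟨C', hC'⟩ := exists_subset_monomialSpan (p := p)
    (Set.finite_range fun x : Fin m × (ι → Fin p) => c x.1 x.2)
    (Set.range_subset_iff.mpr fun x => hc x.1 x.2)
  let D := C + 2 * C'
  have hz : ∀ y, ∃ z : (ι → Fin p) → F, y ∈ monomialSpan p t (D + C) →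
      (∀ h, z h ∈ monomialSpan p t ((D + C) / p)) ∧
        y = ∑ h, z h ^ p * ∏ l, t l ^ (h l : ℕ) := by
    intro y
    by_cases hy : y ∈ monomialSpan p t (D + C)
    · obtain ⟨z, hz⟩ := exists_pow_decomposition hy
      exact ⟨z, fun _ => hz⟩
    · exact ⟨0, fun h => absurd h hy⟩
  choose z hz using hz
  have hD : C' + (D + C) / p ≤ D := by
    have : (D + C) / p ≤ (D + C) / 2 :=
      Nat.div_le_div_left (Fact.out : p.Prime).two_le two_pos
    omega
  refine ⟨monomialSpan p t D, monomialSpan p t (D + C), m, fun b y => ∑ h, c b h * z y h,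
    finite_monomialSpan t D, hC.trans (monomialSpan_mono t (by omega)),
    fun w hw x hx => mul_mem_monomialSpan hw (hC hx), fun b y hy => sum_mem fun h _ => ?_, ?_⟩
  · exact monomialSpan_mono t hD (mul_mem_monomialSpan (hC' ⟨(b, h), rfl⟩) ((hz y hy).1 h))
  · intro J _ y e hy
    have h₁ : ∑ k, y k * e k ^ p =
        ∑ h, (∑ k, z (y k) h * e k) ^ p * ∏ l, t l ^ (h l : ℕ) := by
      simp_rw [sum_pow_char, Finset.sum_mul]
      rw [Finset.sum_comm]
      refine Finset.sum_congr rfl fun k _ => ?_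
      conv_lhs => rw [(hz _ (hy k)).2, Finset.sum_mul]
      exact Finset.sum_congr rfl fun h _ => by ring
    rw [h₁, hceq]
    refine forall_congr' fun b => ?_
    simp_rw [Finset.sum_mul, Finset.mul_sum]
    rw [Finset.sum_comm]
    simp_rw [mul_assoc]

open Polynomial in
lemma LinearRecurrence.isSolution_section {F : Type*} [Field F] (p : ℕ) [Fact p.Prime]
    [CharP F p] (E : LinearRecurrence F) {u : ℕ → F} (hu : E.IsSolution u) (r : ℕ) (n : ℕ) :
    u (p * (n + E.order) + r) = ∑ j, E.coeffs j ^ p * u (p * (n + j) + r) := by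
  let S : (ℕ → F) →ₗ[F] (ℕ → F) := LinearMap.funLeft F F Nat.succ
  have hS : ∀ k v n, (S ^ k) v n = v (n + k) := by
    intro k
    induction k with
    | zero => simp
    | succ k ih =>
      intro v n
      rw [pow_succ', Module.End.mul_apply]
      change (S ^ k) v (n + 1) = _
      rw [ih, add_assoc, add_comm 1 k]
  let P : F[X] := X ^ E.order - ∑ j, C (E.coeffs j) * X ^ (j : ℕ)
  have hP : aeval S P u = 0 := by
    funext n
    simp [P, hS, hu n]
  have hPp : P ^ p = (X ^ E.order) ^ p - ∑ j, (E.coeffs j ^ p) • (X ^ (j : ℕ)) ^ p := by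
    simp only [P, sub_pow_char, sum_pow_char, mul_pow, C_pow, ← C_mul']
  have h : aeval S (P ^ p) u = 0 := by
    rw [← Nat.succ_pred_eq_of_pos (Fact.out : p.Prime).pos, pow_succ, map_mul,
      Module.End.mul_apply, hP, map_zero]
  have h' := congrFun h (p * n + r)
  simp only [hPp, map_sub, map_sum, map_smul, ← pow_mul, aeval_X_pow,
    LinearMap.sub_apply, LinearMap.sum_apply, LinearMap.smul_apply, Pi.sub_apply,
    Finset.sum_apply, Pi.smul_apply, hS, Pi.zero_apply, smul_eq_mul, sub_eq_zero] at h'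
  rw [show p * (n + E.order) + r = p * n + r + E.order * p by ring, h']
  exact Finset.sum_congr rfl fun j _ => by
    rw [show p * n + r + j * p = p * (n + j) + r by ring]

/-- The solution of a linear recurrence whose initial values are those of the `j`-th standard basis
vector. -/
noncomputable def LinearRecurrence.fundamental {F : Type*} [Field F] (E : LinearRecurrence F)
    (j : Fin E.order) : ℕ → F :=
  E.mkSol (Pi.single j 1)

lemma LinearRecurrence.isSolution_fundamental {F : Type*} [Field F] (E : LinearRecurrence F)
    (j : Fin E.order) : E.IsSolution (E.fundamental j) :=
  E.is_sol_mkSol _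

lemma LinearRecurrence.eq_sum_fundamental {F : Type*} [Field F] (E : LinearRecurrence F)
    {u : ℕ → F} (hu : E.IsSolution u) (n : ℕ) : u n = ∑ j : Fin E.order, u j * E.fundamental j n := by
  have hsol : E.IsSolution fun n => ∑ j : Fin E.order, u j * E.fundamental j n := by
    have : (∑ j : Fin E.order, u j • E.fundamental j) ∈ E.solSpace :=
      sum_mem fun j _ => Submodule.smul_mem _ _ (E.isSolution_fundamental j)
    convert (E.is_sol_iff_mem_solSpace _).mpr this using 1
    ext n
    simp
  refine congrFun ((E.eq_iff_eqOn_range_order u _ hu hsol).mpr fun k hk => ?_) n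
  have hk : k < E.order := by simpa using hk
  have hf : ∀ j, E.fundamental j k = Pi.single (M := fun _ => F) j 1 ⟨k, hk⟩ :=
    fun j => E.mkSol_eq_init (Pi.single j 1) ⟨k, hk⟩
  simp [hf, Pi.single_apply]

lemma LinearRecurrence.section_eq_sum_fundamental_pow {F : Type*} [Field F] (p : ℕ) [Fact p.Prime]
    [CharP F p] (E : LinearRecurrence F) {u : ℕ → F} (hu : E.IsSolution u) (r n : ℕ) :
    u (p * n + r) = ∑ k : Fin E.order, u (p * k + r) * E.fundamental k n ^ p := by
  let E' : LinearRecurrence F := ⟨E.order, fun j => E.coeffs j ^ p⟩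
  have h₁ : E'.IsSolution fun n => u (p * n + r) := E.isSolution_section p hu r
  have h₂ : ∀ k, (fun n => E.fundamental k n ^ p) = E'.fundamental k := by
    intro k
    refine E'.eq_mk_of_is_sol_of_eq_init' (fun n => ?_) fun j => ?_
    · change E.fundamental k (n + E.order) ^ p = ∑ j, E.coeffs j ^ p * E.fundamental k (n + j) ^ p
      rw [show E.fundamental k (n + E.order) = _ from E.isSolution_fundamental k n, sum_pow_char]
      simp_rw [mul_pow]
    · change E.mkSol (Pi.single k 1) j ^ p = _
      rw [E.mkSol_eq_init, Pi.single_apply]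
      split_ifs <;> simp [(Fact.out : p.Prime).ne_zero]
  rw [E'.eq_sum_fundamental h₁ n]
  exact Finset.sum_congr rfl fun k _ => by rw [← h₂]

/-- A family of sets that is closed under the sections `n ↦ p * n + r` with `0 ≤ r < p` contains
the `p`-kernel of each of its members. -/
lemma kernel_mem_of_section_mem {p d : ℕ} (hp : 0 < p) {𝒯 : Set (Set (Fin d → ℕ))}
    (h : ∀ T ∈ 𝒯, ∀ r : Fin d → ℕ, (∀ i, r i < p) → {n | (fun i => p * n i + r i) ∈ T} ∈ 𝒯)
    (e : ℕ) : ∀ T ∈ 𝒯, ∀ b : Fin d → ℕ, (∀ i, b i < p ^ e) →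
      {n | (fun i => p ^ e * n i + b i) ∈ T} ∈ 𝒯 := by
  induction e with
  | zero =>
    intro T hT b hb
    have : ∀ i, b i = 0 := fun i => by simpa using hb i
    simp only [pow_zero, one_mul, this, add_zero]
    exact hT
  | succ e ih =>
    intro T hT b hb
    have := ih _ (h T hT (fun i => b i % p) fun i => Nat.mod_lt _ hp) (fun i => b i / p)
      fun i => Nat.div_lt_of_lt_mul (by rw [← pow_succ']; exact hb i)
    have hb' : ∀ (n : Fin d → ℕ) i,
        p ^ (e + 1) * n i + b i = p * (p ^ e * n i + b i / p) + b i % p := fun n i => by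
      rw [mul_add, add_assoc, Nat.div_add_mod, pow_succ', mul_assoc]
    simp_rw [hb']
    exact this

/-- The zero set of a sum of linear recurrences over a finitely generated field of characteristic
`p` has finite `p`-kernel. -/
lemma finite_kernel_of_closure_eq_top {F : Type*} [Field F] (p : ℕ) [Fact p.Prime] [CharP F p]
    {X : Set F} (hX : X.Finite) (hX' : Subfield.closure X = ⊤) {d : ℕ}
    (E : Fin d → LinearRecurrence F) (a : Fin d → ℕ → F) (ha : ∀ i, (E i).IsSolution (a i)) :
    Set.Finite {T : Set (Fin d → ℕ) | ∃ (e : ℕ) (b : Fin d → ℕ), (∀ i, b i < p ^ e) ∧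
      T = {n | ∑ i, a i (p ^ e * n i + b i) = 0}} := by
  let _ : Algebra (ZMod p) F := ZMod.algebra F p
  let J := Σ i : Fin d, Fin (E i).order
  let v : J → ℕ → F := fun x => (E x.1).fundamental x.2
  let A : Set F := Set.range (fun x : J => a x.1 x.2) ∪
    Set.range fun x : Σ i : Fin d, Fin (E i).order × Fin (E i).order × Fin p =>
      (E x.1).fundamental x.2.1 (p * x.2.2.1 + x.2.2.2)
  obtain ⟨W, Y, m, π, hW, hAW, hWA, hπ, heq⟩ := exists_finite_stable_submodule p hX hX'
    (A := A) ((Set.finite_range _).union (Set.finite_range _))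
  let f : (J → F) → (Fin d → ℕ) → F := fun w n => ∑ x : J, w x * v x (n x.1)
  let 𝒲 : Set (J → F) := {w | ∀ x, w x ∈ W}
  let 𝒯 : Set (Set (Fin d → ℕ)) := (fun Ω => {n | ∀ w ∈ Ω, f w n = 0}) '' 𝒲.powerset
  have h𝒯 : 𝒯.Finite := (Set.Finite.pi' fun _ => hW).powerset.image _
  have hf : ∀ w (n r : Fin d → ℕ), f w (fun i => p * n i + r i) = ∑ x : J,
      (∑ j, w ⟨x.1, j⟩ * (E x.1).fundamental j (p * x.2 + r x.1)) * v x (n x.1) ^ p := by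
    intro w n r
    simp only [f, v, J, Fintype.sum_sigma]
    refine Finset.sum_congr rfl fun i _ => ?_
    simp_rw [Finset.sum_mul]
    refine Eq.trans (Finset.sum_congr rfl fun j _ => ?_) Finset.sum_comm
    rw [(E i).section_eq_sum_fundamental_pow p ((E i).isSolution_fundamental j) (r i) (n i),
      Finset.mul_sum]
    simp_rw [mul_assoc]
  refine h𝒯.subset ?_
  rintro _ ⟨e, b, hb, rfl⟩
  refine kernel_mem_of_section_mem (T := {n | ∑ i, a i (n i) = 0}) (Fact.out : p.Prime).pos
    ?_ e ?_ b hb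
  · rintro _ ⟨Ω, hΩ, rfl⟩ r hr
    let y : (J → F) → J → F := fun w x =>
      ∑ j, w ⟨x.1, j⟩ * (E x.1).fundamental j (p * x.2 + r x.1)
    have hy : ∀ w ∈ Ω, ∀ x, y w x ∈ Y := fun w hw x => sum_mem fun j _ =>
      hWA _ (hΩ hw _) _ (Or.inr ⟨⟨x.1, j, x.2, ⟨r x.1, hr x.1⟩⟩, rfl⟩)
    refine ⟨{w' | ∃ w ∈ Ω, ∃ c, w' = fun x => π c (y w x)}, ?_, ?_⟩
    · rintro _ ⟨w, hw, c, rfl⟩ x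
      exact hπ c _ (hy w hw x)
    · ext n
      have key : ∀ w ∈ Ω, f w (fun i => p * n i + r i) = 0 ↔
          ∀ c, f (fun x => π c (y w x)) n = 0 := fun w hw => by
        rw [hf]
        exact heq J (y w) (fun x => v x (n x.1)) (hy w hw)
      constructor
      · intro h w hw
        exact (key w hw).mpr fun c => h _ ⟨w, hw, c, rfl⟩
      · rintro h _ ⟨w, hw, c, rfl⟩
        exact (key w hw).mp (h w hw) c
  · refine ⟨{fun x => a x.1 x.2}, ?_, ?_⟩
    · rintro _ rfl x
      exact hAW (Or.inl ⟨x, rfl⟩)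
    · ext n
      simp only [Set.mem_singleton_iff, forall_eq, Set.mem_ofPred_eq, f, v, J,
        Fintype.sum_sigma, ← fun i => (E i).eq_sum_fundamental (ha i) (n i)]

lemma Subfield.closure_closure_coe_preimage {K : Type*} [Field K] (X : Set K) :
    Subfield.closure (((↑) : Subfield.closure X → K) ⁻¹' X) = ⊤ := by
  rw [eq_top_iff]
  rintro ⟨x, hx⟩ -
  induction hx using Subfield.closure_induction with
  | mem x hx => exact Subfield.subset_closure hx
  | one => exact one_mem _
  | add x y _ _ hx hy => exact add_mem hx hy
  | neg x _ hx => exact neg_mem hx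
  | inv x _ hx => exact inv_mem hx
  | mul x y _ _ hx hy => exact mul_mem hx hy


/-- for linear recurrence sequences `a_1, …, a_d` over a field of
characteristic `p`, the set `{(n_1,…,n_d) : a_1(n_1) + ⋯ + a_d(n_d) = 0}` is
`p`-automatic, i.e. its `p`-kernel is finite. -/
theorem zero_set_of_sum_of_linear_recurrences_automatic
    (p : ℕ) (hp : p.Prime) (K : Type*) [Field K] [CharP K p]
    (d : ℕ) (hd : 0 < d) (a : Fin d → ℕ → K)
    (hrec : ∀ i : Fin d, ∃ m : ℕ, 0 < m ∧ ∃ c : Fin m → K, ∃ N : ℕ,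
        ∀ n, N ≤ n → a i (n + m) = ∑ j : Fin m, c j * a i (n + j)) :
    Set.Finite { T : Set (Fin d → ℕ) |
      ∃ (e : ℕ) (b : Fin d → ℕ), (∀ i, b i < p ^ e) ∧
        T = { n : Fin d → ℕ | (fun i => p ^ e * n i + b i) ∈
          { m : Fin d → ℕ | ∑ i : Fin d, a i (m i) = 0 } } } := by
  have : Fact p.Prime := ⟨hp⟩
  have hE : ∀ i, ∃ E : LinearRecurrence K, E.IsSolution (a i) := by
    intro i
    obtain ⟨m, -, c, N, h⟩ := hrec i
    refine ⟨⟨N + m, Fin.append 0 c⟩, fun n => ?_⟩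
    simp [Fin.sum_univ_add, ← add_assoc, h (n + N) (Nat.le_add_left N n)]
  choose E hE using hE
  let X : Set K := Set.range (fun x : Σ i, Fin (E i).order => a x.1 x.2) ∪
    Set.range fun x : Σ i, Fin (E i).order => (E x.1).coeffs x.2
  have hX : X.Finite := (Set.finite_range _).union (Set.finite_range _)
  let F := Subfield.closure X
  have hc : ∀ i j, (E i).coeffs j ∈ F := fun i j =>
    Subfield.subset_closure (Or.inr ⟨⟨i, j⟩, rfl⟩)
  let E' : Fin d → LinearRecurrence F := fun i => ⟨(E i).order, fun j => ⟨_, hc i j⟩⟩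
  let a' : Fin d → ℕ → F := fun i => (E' i).mkSol fun j =>
    ⟨a i j, Subfield.subset_closure (Or.inl ⟨⟨i, j⟩, rfl⟩)⟩
  have ha : ∀ i n, (a' i n : K) = a i n := by
    intro i n
    refine congrFun (((E i).eq_iff_eqOn_range_order (fun n => (a' i n : K)) (a i) (fun n => ?_)
      (hE i)).mpr fun k hk => ?_) n
    · have h : a' i (n + (E i).order) = _ := (E' i).is_sol_mkSol _ n
      simp only [h, AddSubmonoidClass.coe_finsetSum, MulMemClass.coe_mul]
      rfl
    · have hk : k < (E i).order := by simpa using hk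
      exact congrArg Subtype.val ((E' i).mkSol_eq_init _ ⟨k, hk⟩)
  have h := finite_kernel_of_closure_eq_top p (hX.preimage Subtype.val_injective.injOn)
    (Subfield.closure_closure_coe_preimage X) E' a' fun i => (E' i).is_sol_mkSol _
  refine h.subset ?_
  rintro _ ⟨e, b, hb, rfl⟩
  refine ⟨e, b, hb, ?_⟩
  ext n
  rw [Set.mem_ofPred_eq, Set.mem_ofPred_eq, Set.mem_ofPred_eq, ← Subtype.coe_inj]
  simp [ha]
end

section
/- Let p be a prime number, K a field of characteristic p, d a positive integer, c_1,…,c_d ∈ K nonzero elements, and Γ a finitely generated subgroup of the multiplicative group K^*. Then the set S = {(x_1,…,x_d) ∈ Γ^d : c_1 x_1 + ⋯ + c_d x_d = 1} is a p-automatic subset of the finitely generated abelian group Γ^d: for every finite family γ_1,…,γ_m of elements generating the group Γ^d, the set of functions Γ^d → {0,1} of the form x ↦ χ_S(x^{p^a} · γ_1^{b_1} ⋯ γ_m^{b_m}), where a ∈ ℕ and 0 ≤ b_j < p^a for all j, is finite (here χ_S is the characteristic function of S and x^{p^a} denotes the p^a-th power in the group Γ^d). -/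
universe u

/-- Coordinates with respect to a basis of a field of characteristic `p` over its subfield of `p`-th
powers, with the `p`-th roots taken. -/
theorem exists_frobenius_coordinates (p : ℕ) [Fact p.Prime] (L : Type u) [Field L] [CharP L p] :
    ∃ (ι : Type u) (φ : ι → L →+ L),
      (∀ β x y, φ β (x * y ^ p) = φ β x * y) ∧
      (∀ x, (∀ β, φ β x = 0) → x = 0) ∧
      ∀ x, (Set.range fun β => φ β x).Finite := by
  let k := (frobenius L p).fieldRange
  let e : L ≃+* k := (frobenius L p).rangeRestrictFieldEquiv
  let b := Module.Basis.ofVectorSpace k L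
  refine ⟨_, fun β => (e.symm : k →+ L).comp (b.coord β).toAddMonoidHom, ?_, ?_, ?_⟩
  · intro β x y
    have h : x * y ^ p = e y • x := by
      rw [mul_comm]
      rfl
    simp [h, mul_comm]
  · intro x hx
    apply b.repr.map_eq_zero_iff.mp
    ext1 β
    simpa using hx β
  · intro x
    refine (((b.repr x).finite_range).image e.symm).subset ?_
    rintro _ ⟨β, rfl⟩
    exact ⟨b.repr x β, ⟨β, rfl⟩, rfl⟩

open MvPolynomial in
theorem exists_common_denominator_s5 {R σ L : Type*} [CommRing R] [Field L] [Algebra R L]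
    (z : σ → L) (hz : ∀ x, ∃ r s : MvPolynomial σ R, x = aeval z r / aeval z s)
    {U : Set L} (hU : U.Finite) :
    ∃ H : MvPolynomial σ R, aeval z H ≠ 0 ∧ ∀ x ∈ U, ∃ u : MvPolynomial σ R, aeval z u = aeval z H * x := by
  induction U, hU using Set.Finite.induction_on with
  | empty => exact ⟨1, by simp, by simp⟩
  | @insert a U _ _ ih =>
    obtain ⟨H, hH, hu⟩ := ih
    by_cases ha : a = 0
    · refine ⟨H, hH, ?_⟩
      rintro x (rfl | hx)
      · exact ⟨0, by simp [ha]⟩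
      · exact hu x hx
    · obtain ⟨r, s, rfl⟩ := hz a
      have hs : aeval z s ≠ 0 := fun h => ha (by simp [h])
      refine ⟨H * s, by simp [hH, hs], ?_⟩
      rintro x (rfl | hx)
      · exact ⟨H * r, by simp only [map_mul]; field_simp⟩
      · obtain ⟨u, hu⟩ := hu x hx
        exact ⟨u * s, by simp only [map_mul, hu]; ring⟩

open MvPolynomial in
theorem finite_setOf_totalDegree_le (R σ : Type*) [CommRing R] [Finite R] [Finite σ] (n : ℕ) :
    {f : MvPolynomial σ R | f.totalDegree ≤ n}.Finite := by
  have h : Finite (restrictTotalDegree σ R n) := Module.finite_of_finite R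
  refine (Set.toFinite (restrictTotalDegree σ R n : Set (MvPolynomial σ R))).subset ?_
  intro f hf
  exact (mem_restrictTotalDegree σ n f).mpr hf

theorem Set.Finite.exists_forall_exists_le {α β : Type*} [Nonempty β] {U : Set α} (hU : U.Finite)
    {P : α → β → Prop} (h : ∀ x ∈ U, ∃ y, P x y) (deg : β → ℕ) :
    ∃ E, ∀ x ∈ U, ∃ y, P x y ∧ deg y ≤ E := by
  choose! u hu using h
  obtain ⟨E, hE⟩ := (hU.image fun x => deg (u x)).bddAbove
  exact ⟨E, fun x hx => ⟨u x, hu x hx, hE ⟨x, hx, rfl⟩⟩⟩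

open MvPolynomial in
/-- The coordinate maps divide degrees by `p`, up to a bounded error and a fixed denominator. -/
theorem exists_totalDegree_frobenius_coordinate_le (p : ℕ) [Fact p.Prime] {L : Type*} [Field L]
    [Algebra (ZMod p) L] {σ : Type*} [Finite σ] (z : σ → L)
    (hz : ∀ x, ∃ r s : MvPolynomial σ (ZMod p), x = aeval z r / aeval z s)
    {ι : Type*} (φ : ι → L →+ L) (hφ : ∀ β x y, φ β (x * y ^ p) = φ β x * y)
    (hfin : ∀ x, (Set.range fun β => φ β x).Finite) :
    ∃ (H : MvPolynomial σ (ZMod p)) (E : ℕ), aeval z H ≠ 0 ∧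
      ∀ f : MvPolynomial σ (ZMod p), ∀ β, ∃ g : MvPolynomial σ (ZMod p),
        g.totalDegree ≤ f.totalDegree / p + E ∧ aeval z g = aeval z H * φ β (aeval z f) := by
  have hp : 0 < p := (Fact.out : p.Prime).pos
  have := Fintype.ofFinite σ
  let U : Set L := ⋃ t : σ → Fin p, Set.range fun β => φ β (∏ i, z i ^ (t i : ℕ))
  have hU : U.Finite := Set.finite_iUnion fun t => hfin _
  obtain ⟨H, hH, hu⟩ := exists_common_denominator_s5 z hz hU
  obtain ⟨E, hE⟩ := hU.exists_forall_exists_le hu totalDegree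
  refine ⟨H, E, hH, fun f β => ?_⟩
  have hmon : ∀ e : σ →₀ ℕ, ∃ g : MvPolynomial σ (ZMod p), g.totalDegree ≤ e.degree / p + E ∧
      aeval z g = aeval z H * φ β (aeval z (monomial e (f.coeff e))) := by
    intro e
    obtain ⟨u, hu, huE⟩ := hE (φ β (∏ i, z i ^ (e i % p)))
      (Set.mem_iUnion.mpr ⟨fun i => ⟨e i % p, Nat.mod_lt _ hp⟩, β, rfl⟩)
    let e' : σ →₀ ℕ := e.mapRange (· / p) (Nat.zero_div p)
    refine ⟨monomial e' (f.coeff e) * u, ?_, ?_⟩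
    · refine (totalDegree_mul _ _).trans (add_le_add ?_ huE)
      refine (totalDegree_monomial_le _ _).trans ?_
      rw [Nat.le_div_iff_mul_le hp]
      change e'.degree * p ≤ e.degree
      rw [Finsupp.degree_eq_sum, Finsupp.degree_eq_sum, Finset.sum_mul]
      exact Finset.sum_le_sum fun i _ => Nat.div_mul_le_self _ _
    · have h : aeval z (monomial e (f.coeff e)) =
          (∏ i, z i ^ (e i % p)) * aeval z (monomial e' (f.coeff e)) ^ p := by
        simp only [aeval_monomial, Finsupp.prod_fintype _ _ (fun i => pow_zero (z i))]
        rw [mul_pow, ← map_pow, ZMod.pow_card, ← Finset.prod_pow, mul_left_comm,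
          ← Finset.prod_mul_distrib]
        congr 1
        refine Finset.prod_congr rfl fun i _ => ?_
        rw [← pow_mul, ← pow_add]
        congr 1
        exact (Nat.mod_add_div' (e i) p).symm
      rw [h, hφ, map_mul, hu]
      ring
  choose g hg hg' using hmon
  refine ⟨∑ e ∈ f.support, g e, ?_, ?_⟩
  · refine (totalDegree_finsetSum _ _).trans (Finset.sup_le fun e he => (hg e).trans ?_)
    gcongr
    exact le_totalDegree he
  · conv_rhs => rw [f.as_sum]
    rw [map_sum, map_sum, map_sum, Finset.mul_sum]
    exact Finset.sum_congr rfl fun e _ => hg' e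

open MvPolynomial in
/-- A finite subset of a finitely generated field of characteristic `p` is contained in a finite
subset stable under multiplication by it followed by any of the coordinate maps. -/
theorem exists_finite_frobenius_stable (p : ℕ) [Fact p.Prime] {L : Type*} [Field L]
    [Algebra (ZMod p) L] {σ : Type*} [Finite σ] (z : σ → L)
    (hz : ∀ x, ∃ r s : MvPolynomial σ (ZMod p), x = aeval z r / aeval z s)
    {ι : Type*} (φ : ι → L →+ L) (hφ : ∀ β x y, φ β (x * y ^ p) = φ β x * y)
    (hfin : ∀ x, (Set.range fun β => φ β x).Finite) {G : Set L} (hG : G.Finite) :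
    ∃ W : Set L, W.Finite ∧ G ⊆ W ∧ ∀ w ∈ W, ∀ g ∈ G, ∀ β, φ β (w * g) ∈ W := by
  have hp : 2 ≤ p := (Fact.out : p.Prime).two_le
  obtain ⟨H₁, E, hH₁, hE⟩ := exists_totalDegree_frobenius_coordinate_le p z hz φ hφ hfin
  obtain ⟨H₂, hH₂, hu⟩ := exists_common_denominator_s5 z hz hG
  obtain ⟨C, hC⟩ := hG.exists_forall_exists_le hu totalDegree
  set h₁ := aeval z H₁ with hh₁
  set h₂ := aeval z H₂ with hh₂
  set B := (H₁ * H₂).totalDegree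
  have hh : h₁ * h₂ = aeval z (H₁ * H₂) := by rw [map_mul]
  set h := h₁ * h₂ with hdef
  have hne : h ≠ 0 := mul_ne_zero hH₁ hH₂
  have hGpoly : ∀ g ∈ G, ∃ u : MvPolynomial σ (ZMod p),
      aeval z u = h * g ∧ u.totalDegree ≤ H₁.totalDegree + C := by
    intro g hg
    obtain ⟨u, hu, hd⟩ := hC g hg
    refine ⟨H₁ * u, ?_, (totalDegree_mul _ _).trans (by gcongr)⟩
    rw [map_mul, hu, hdef]
    ring
  have hφh : ∀ f : MvPolynomial σ (ZMod p), ∀ β, ∃ g : MvPolynomial σ (ZMod p),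
      g.totalDegree ≤ f.totalDegree / p + (E + H₂.totalDegree) ∧
        aeval z g = h * φ β (aeval z f) := by
    intro f β
    obtain ⟨g, hd, hg⟩ := hE f β
    refine ⟨g * H₂, (totalDegree_mul _ _).trans (by omega), ?_⟩
    rw [map_mul, hg, hdef]
    ring
  set C' := H₁.totalDegree + C
  set E' := E + H₂.totalDegree
  set N := C' + 2 * (p * B) + 2 * E' with hN
  have hpB : B ≤ p * B := Nat.le_mul_of_pos_left _ (by omega)
  have hpow : ∀ n : ℕ, ((H₁ * H₂) ^ n).totalDegree ≤ n * B := fun n => totalDegree_pow _ _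
  refine ⟨(fun f => aeval z f / h ^ 3) '' {f : MvPolynomial σ (ZMod p) | f.totalDegree ≤ N},
    (finite_setOf_totalDegree_le _ _ _).image _, ?_, ?_⟩
  · intro g hg
    obtain ⟨u, hu, hd⟩ := hGpoly g hg
    refine ⟨(H₁ * H₂) ^ 2 * u, ?_, ?_⟩
    · have := totalDegree_mul ((H₁ * H₂) ^ 2) u
      have := hpow 2
      simp only [Set.mem_ofPred_eq]
      omega
    · simp only [map_mul, map_pow, hu, ← hh₁, ← hh₂, ← hdef]
      field_simp
  · rintro _ ⟨f, hf, rfl⟩ g hg β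
    obtain ⟨u, hu, hd⟩ := hGpoly g hg
    obtain ⟨v, hvd, hv⟩ := hφh ((H₁ * H₂) ^ (2 * p - 4) * (f * u)) β
    refine ⟨v, ?_, ?_⟩
    · have h1 := totalDegree_mul ((H₁ * H₂) ^ (2 * p - 4)) (f * u)
      have h2 := totalDegree_mul f u
      have h3 := hpow (2 * p - 4)
      have h4 : (2 * p - 4) * B ≤ 2 * (p * B) := by
        rw [← mul_assoc]
        exact Nat.mul_le_mul_right _ (Nat.sub_le _ _)
      have h5 := Nat.div_le_div_left hp (by omega)
        (a := ((H₁ * H₂) ^ (2 * p - 4) * (f * u)).totalDegree)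
      simp only [Set.mem_ofPred_eq] at hf ⊢
      omega
    · have key : aeval z f / h ^ 3 * g =
          aeval z ((H₁ * H₂) ^ (2 * p - 4) * (f * u)) * ((h ^ 2)⁻¹) ^ p := by
        have hpp : h ^ (2 * p) = h ^ (2 * p - 4) * h ^ 4 := by
          rw [← pow_add]
          congr 1
          omega
        simp only [map_mul, map_pow, hu, ← hh₁, ← hh₂, ← hdef]
        rw [inv_pow, ← pow_mul, hpp]
        field_simp
      simp only [key, hφ, hv]
      field_simp

/-- The solutions of a system of linear equations in the values of characters on a group. -/
def systemSolutions {Y L : Type*} [CommGroup Y] [Field L] {d : ℕ} (f : Fin d → Y →* L)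
    (Q : Set ((Fin d → L) × L)) : Set Y :=
  {y | ∀ q ∈ Q, ∑ i, q.1 i * f i y = q.2}

/-- The system obtained from `Q` by substituting `y ^ p * g` for `y` and taking coordinates. -/
def systemStep {Y L ι : Type*} [CommGroup Y] [Field L] {d : ℕ} (f : Fin d → Y →* L)
    (φ : ι → L →+ L) (g : Y) (Q : Set ((Fin d → L) × L)) : Set ((Fin d → L) × L) :=
  {q' | ∃ β, ∃ q ∈ Q, q' = (fun i => φ β (q.1 i * f i g), φ β q.2)}

theorem mem_systemSolutions_systemStep {p : ℕ} {Y L ι : Type*} [CommGroup Y] [Field L] {d : ℕ}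
    (f : Fin d → Y →* L) {φ : ι → L →+ L} (hφ : ∀ β x y, φ β (x * y ^ p) = φ β x * y)
    (hinj : ∀ x, (∀ β, φ β x = 0) → x = 0) (g : Y) (Q : Set ((Fin d → L) × L)) (y : Y) :
    y ∈ systemSolutions f (systemStep f φ g Q) ↔ y ^ p * g ∈ systemSolutions f Q := by
  have h : ∀ (q : (Fin d → L) × L) β, φ β (∑ i, q.1 i * f i (y ^ p * g) - q.2) =
      ∑ i, φ β (q.1 i * f i g) * f i y - φ β q.2 := by
    intro q β
    rw [map_sub, map_sum]
    congr 1
    refine Finset.sum_congr rfl fun i _ => ?_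
    rw [← hφ, map_mul (f i), map_pow (f i)]
    congr 1
    ring
  constructor
  · intro hy q hq
    refine sub_eq_zero.mp (hinj _ fun β => ?_)
    rw [h, sub_eq_zero]
    exact hy _ ⟨β, q, hq, rfl⟩
  · rintro hy _ ⟨β, q, hq, rfl⟩
    rw [← sub_eq_zero, ← h, sub_eq_zero.mpr (hy q hq), map_zero]

theorem exists_systemSolutions_eq_preimage {p : ℕ} (hp : 0 < p) {Y L ι : Type*} [CommGroup Y]
    [Field L] {d m : ℕ} (f : Fin d → Y →* L) {φ : ι → L →+ L}
    (hφ : ∀ β x y, φ β (x * y ^ p) = φ β x * y) (hinj : ∀ x, (∀ β, φ β x = 0) → x = 0)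
    (γ : Fin m → Y) {W : Set L}
    (hW : ∀ w ∈ W, ∀ (t : Fin m → Fin p) i β, φ β (w * f i (∏ j, γ j ^ (t j : ℕ))) ∈ W)
    (hW₁ : ∀ w ∈ W, ∀ β, φ β w ∈ W) (a : ℕ) :
    ∀ (b : Fin m → ℕ), (∀ j, b j < p ^ a) →
      ∀ Q ⊆ {q : (Fin d → L) × L | (∀ i, q.1 i ∈ W) ∧ q.2 ∈ W},
      ∃ Q' ⊆ {q : (Fin d → L) × L | (∀ i, q.1 i ∈ W) ∧ q.2 ∈ W},
        systemSolutions f Q' = {x | x ^ p ^ a * ∏ j, γ j ^ b j ∈ systemSolutions f Q} := by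
  induction a with
  | zero =>
    intro b hb Q hQ
    refine ⟨Q, hQ, ?_⟩
    have hb' : ∀ j, b j = 0 := fun j => by simpa using hb j
    simp [hb']
  | succ a ih =>
    intro b hb Q hQ
    let t : Fin m → Fin p := fun j => ⟨b j % p, Nat.mod_lt _ hp⟩
    obtain ⟨Q', hQ', h⟩ := ih (fun j => b j / p)
      (fun j => Nat.div_lt_of_lt_mul (by rw [← pow_succ']; exact hb j))
      (systemStep f φ (∏ j, γ j ^ (t j : ℕ)) Q) (by
        rintro _ ⟨β, q, hq, rfl⟩
        exact ⟨fun i => hW _ ((hQ hq).1 i) t i β, hW₁ _ (hQ hq).2 β⟩)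
    refine ⟨Q', hQ', h.trans ?_⟩
    ext x
    rw [Set.mem_ofPred_eq, mem_systemSolutions_systemStep f hφ hinj, Set.mem_ofPred_eq]
    have hx : (x ^ p ^ a * ∏ j, γ j ^ (b j / p)) ^ p * ∏ j, γ j ^ (t j : ℕ) =
        x ^ p ^ (a + 1) * ∏ j, γ j ^ b j := by
      rw [mul_pow, ← pow_mul, ← pow_succ, mul_assoc, ← Finset.prod_pow, ← Finset.prod_mul_distrib]
      congr 1
      refine Finset.prod_congr rfl fun j _ => ?_
      rw [← pow_mul, ← pow_add, Nat.div_add_mod']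
    rw [hx]

theorem finite_kernel_linear_equation (p : ℕ) [Fact p.Prime] {L : Type*} [Field L]
    [Algebra (ZMod p) L] {σ : Type*} [Finite σ] (z : σ → L)
    (hz : ∀ x, ∃ r s : MvPolynomial σ (ZMod p),
      x = MvPolynomial.aeval z r / MvPolynomial.aeval z s)
    {Y : Type*} [CommGroup Y] {d m : ℕ} (f : Fin d → Y →* L) (c : Fin d → L) (γ : Fin m → Y) :
    {T : Set Y | ∃ (a : ℕ) (b : Fin m → ℕ), (∀ j, b j < p ^ a) ∧
      T = {x | ∑ i, c i * f i (x ^ p ^ a * ∏ j, γ j ^ b j) = 1}}.Finite := by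
  have hp : 0 < p := (Fact.out : p.Prime).pos
  have : CharP L p := charP_of_injective_algebraMap' (ZMod p) p
  obtain ⟨ι, φ, hφ, hinj, hfin⟩ := exists_frobenius_coordinates p L
  let G : Set L := insert 1 (Set.range c ∪
    Set.range fun s : Fin d × (Fin m → Fin p) => f s.1 (∏ j, γ j ^ (s.2 j : ℕ)))
  have hG : G.Finite := ((Set.finite_range _).union (Set.finite_range _)).insert 1
  obtain ⟨W, hWfin, hGW, hW⟩ := exists_finite_frobenius_stable p z hz φ hφ hfin hG
  let Ω : Set ((Fin d → L) × L) := {q | (∀ i, q.1 i ∈ W) ∧ q.2 ∈ W}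
  have hΩ : Ω.Finite := ((Set.Finite.pi' fun _ : Fin d => hWfin).prod hWfin).subset fun q hq => hq
  refine (hΩ.finite_subsets.image (systemSolutions f)).subset ?_
  rintro _ ⟨a, b, hb, rfl⟩
  obtain ⟨Q', hQ', h⟩ := exists_systemSolutions_eq_preimage hp f hφ hinj γ (W := W)
    (fun w hw t i β => hW w hw _ (Or.inr (Or.inr ⟨(i, t), rfl⟩)) β)
    (fun w hw β => by simpa using hW w hw 1 (Or.inl rfl) β) a b hb {(c, 1)} (by
      rintro _ rfl
      exact ⟨fun i => hGW (Or.inr (Or.inl ⟨i, rfl⟩)), hGW (Or.inl rfl)⟩)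
  refine ⟨Q', hQ', h.trans ?_⟩
  ext x
  simp [systemSolutions]

/-- over a field `K` of characteristic `p`, the set of solutions in
`Γ^d` of `c_1 x_1 + ⋯ + c_d x_d = 1` (with `Γ ≤ K^*` finitely generated) is a
`p`-automatic subset of the finitely generated abelian group `Γ^d`. -/
theorem unit_equation_solutions_automatic
    (p : ℕ) (hp : p.Prime) (K : Type*) [Field K] [CharP K p]
    (d : ℕ) (hd : 0 < d) (c : Fin d → K) (hc : ∀ i, c i ≠ 0)
    (Γ : Subgroup Kˣ) (hΓ : Group.FG ↥Γ) :
    ∀ (m : ℕ) (γ : Fin m → (Fin d → ↥Γ)),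
      Subgroup.closure (Set.range γ) = ⊤ →
      Set.Finite { T : Set (Fin d → ↥Γ) |
        ∃ (a : ℕ) (b : Fin m → ℕ), (∀ j, b j < p ^ a) ∧
          T = { x : Fin d → ↥Γ |
            x ^ (p ^ a) * ∏ j : Fin m, γ j ^ b j ∈
              { y : Fin d → ↥Γ | ∑ i : Fin d, c i * ((y i : Kˣ) : K) = 1 } } } := by
  have : Fact p.Prime := ⟨hp⟩
  let _ : Algebra (ZMod p) K := ZMod.algebra K p
  obtain ⟨S, hS, hSfin⟩ := Group.fg_iff.mp hΓ
  have : Finite S := hSfin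
  let z : Fin d ⊕ S → K := Sum.elim c fun s => ((s : Γ) : Kˣ)
  let L := IntermediateField.adjoin (ZMod p) (Set.range z)
  let z' : Fin d ⊕ S → L := fun i => ⟨z i, IntermediateField.subset_adjoin _ _ ⟨i, rfl⟩⟩
  have hz : ∀ x : L, ∃ r s : MvPolynomial (Fin d ⊕ S) (ZMod p),
      x = MvPolynomial.aeval z' r / MvPolynomial.aeval z' s := by
    intro x
    obtain ⟨r, s, h⟩ := (IntermediateField.mem_adjoin_range_iff (ZMod p) z (x : K)).mp x.2
    have hval : ∀ q : MvPolynomial (Fin d ⊕ S) (ZMod p),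
        ((MvPolynomial.aeval z' q : L) : K) = MvPolynomial.aeval z q := fun q =>
      MvPolynomial.comp_aeval_apply z' L.val q
    refine ⟨r, s, Subtype.ext ?_⟩
    rw [h, ← hval r, ← hval s]
    rfl
  have hΓL : ∀ x : Γ, ((x : Kˣ) : K) ∈ L := by
    intro x
    have hx : x ∈ Subgroup.closure S := hS ▸ Subgroup.mem_top x
    induction hx using Subgroup.closure_induction with
    | mem s hs => exact IntermediateField.subset_adjoin _ _ ⟨Sum.inr ⟨s, hs⟩, rfl⟩
    | one => simp
    | mul x y _ _ hx hy => simpa using mul_mem hx hy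
    | inv x _ hx => simpa using inv_mem hx
  let f : Fin d → (Fin d → Γ) →* L := fun i =>
    { toFun := fun x => ⟨((x i : Kˣ) : K), hΓL (x i)⟩
      map_one' := by ext; simp
      map_mul' := fun x y => by ext; simp }
  intro m γ _
  refine (finite_kernel_linear_equation p z' hz f (fun i => z' (Sum.inl i)) γ).subset ?_
  rintro _ ⟨a, b, hb, rfl⟩
  refine ⟨a, b, hb, ?_⟩
  ext x
  simp only [Set.mem_ofPred_eq]
  rw [← Subtype.coe_inj]
  simp [f, z', z]
end

section
/- Let p be a prime number, K a field of characteristic p, and d a positive integer. Let X be a Zariski closed subset of GL_d(K), i.e., there are finitely many polynomials P_1,…,P_r in the d² matrix entries such that X = {M ∈ GL_d(K) : P_1(M) = ⋯ = P_r(M) = 0}, and let Γ be a finitely generated abelian (commutative) subgroup of GL_d(K). Then X ∩ Γ is a p-automatic subset of Γ: for every finite family γ_1,…,γ_m of elements generating the group Γ, the set of functions Γ → {0,1} of the form M ↦ χ_{X∩Γ}(M^{p^a} · γ_1^{b_1} ⋯ γ_m^{b_m}), where a ∈ ℕ and 0 ≤ b_j < p^a for all j, is finite. -/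
open Matrix

namespace MvPolynomial

variable {σ k : Type*} [CommRing k]

/-- The section of `v` along the exponents congruent to `e` modulo `q`: its coefficient at `s` is
the coefficient of `v` at `q • s + e`. -/
noncomputable def cartier (q : ℕ) (hq : q ≠ 0) (e : σ →₀ ℕ) :
    MvPolynomial σ k →+ MvPolynomial σ k where
  toFun v := .ofCoeff (Finsupp.comapDomain (fun s => q • s + e) (AddMonoidAlgebra.coeff v)
    fun _ _ _ _ h => nsmul_right_injective hq (add_right_cancel h))
  map_zero' := by
    ext s
    simp [coeff]
  map_add' v w := by
    ext s
    rw [coeff_add]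
    exact Finsupp.add_apply _ _ _

variable {q : ℕ} (hq : q ≠ 0)

@[simp]
theorem coeff_cartier (e s : σ →₀ ℕ) (v : MvPolynomial σ k) :
    coeff s (cartier q hq e v) = coeff (q • s + e) v :=
  rfl

theorem cartier_expand_mul {e : σ →₀ ℕ} (he : ∀ i, e i < q) (u v : MvPolynomial σ k) :
    cartier q hq e (expand q u * v) = u * cartier q hq e v := by
  induction u using MvPolynomial.induction_on' with
  | monomial s c =>
    ext t
    have hiff : q • s ≤ q • t + e ↔ s ≤ t := by
      refine forall_congr' fun i => ?_
      have := he i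
      simp only [Finsupp.smul_apply, Finsupp.add_apply, smul_eq_mul]
      constructor
      · intro h
        by_contra! hlt
        have : q * (t i + 1) ≤ q * s i := Nat.mul_le_mul_left q hlt
        rw [mul_add] at this
        omega
      · intro h
        exact (Nat.mul_le_mul_left q h).trans (Nat.le_add_right _ _)
    rw [coeff_cartier, expand_monomial, coeff_monomial_mul', coeff_monomial_mul']
    simp only [hiff]
    split_ifs with h
    · rw [coeff_cartier]
      congr 2
      ext i
      have := Nat.mul_le_mul_left q (h i)
      simp only [Finsupp.smul_apply, Finsupp.add_apply, Finsupp.tsub_apply, smul_eq_mul,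
        Nat.mul_sub]
      omega
    · rfl
  | add u u' hu hu' => rw [map_add, add_mul, map_add, hu, hu', add_mul]

theorem eq_zero_iff_forall_cartier_eq_zero (v : MvPolynomial σ k) :
    v = 0 ↔ ∀ e : σ →₀ ℕ, (∀ i, e i < q) → cartier q hq e v = 0 := by
  refine ⟨fun h e _ => by rw [h, map_zero], fun h => ?_⟩
  ext s
  have hs := congrArg (coeff (s.mapRange (· / q) (Nat.zero_div q)))
    (h (s.mapRange (· % q) (Nat.zero_mod q)) fun i => Nat.mod_lt _ (Nat.pos_of_ne_zero hq))
  rw [coeff_cartier, coeff_zero] at hs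
  rw [coeff_zero, ← hs]
  congr 1
  ext i
  simp [Nat.div_add_mod]

theorem totalDegree_cartier_le {c : ℕ} {v : MvPolynomial σ k} (hv : v.totalDegree ≤ c * q)
    (e : σ →₀ ℕ) : (cartier q hq e v).totalDegree ≤ c := by
  refine Finset.sup_le fun s hs => ?_
  rw [mem_support_iff, coeff_cartier] at hs
  have hle := (le_totalDegree (mem_support_iff.mpr hs)).trans hv
  change (q • s + e).degree ≤ _ at hle
  change s.degree ≤ c
  rw [map_add, map_nsmul, smul_eq_mul, mul_comm c] at hle
  exact Nat.le_of_mul_le_mul_left ((Nat.le_add_right _ _).trans hle) (Nat.pos_of_ne_zero hq)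

theorem expand_zmod_pow {p : ℕ} [Fact p.Prime] (a : ℕ) (f : MvPolynomial σ (ZMod p)) :
    expand (p ^ a) f = f ^ p ^ a := by
  induction a with
  | zero => simp
  | succ a ih => rw [pow_succ, expand_mul, expand_zmod, map_pow, ih, pow_mul]

theorem sum_pow_mul_eq_zero_iff {p : ℕ} [Fact p.Prime] {ι : Type*} [Fintype ι] (a : ℕ)
    (x v : ι → MvPolynomial σ (ZMod p)) (hq : p ^ a ≠ 0) :
    ∑ i, x i ^ p ^ a * v i = 0 ↔
      ∀ e : σ →₀ ℕ, (∀ i, e i < p ^ a) → ∑ i, x i * cartier (p ^ a) hq e (v i) = 0 := by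
  rw [eq_zero_iff_forall_cartier_eq_zero hq]
  refine forall₂_congr fun e he => ?_
  simp only [map_sum, ← expand_zmod_pow, cartier_expand_mul hq he]

theorem finite_totalDegree_le [Finite σ] [Finite k] (c : ℕ) :
    {v : MvPolynomial σ k | v.totalDegree ≤ c}.Finite := by
  have : Finite (restrictTotalDegree σ k c) := Module.finite_of_finite k
  exact (Set.toFinite (restrictTotalDegree σ k c : Set (MvPolynomial σ k))).subset fun v hv =>
    (mem_restrictTotalDegree σ c v).mpr hv

end MvPolynomial

/-- A finite torsion-free module over a Noetherian domain embeds into a finite free module. -/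
theorem exists_injective_to_pi (S M : Type*) [CommRing S] [IsDomain S] [IsNoetherianRing S]
    [AddCommGroup M] [Module S M] [Module.Finite S M] [Module.IsTorsionFree S M] :
    ∃ (n : ℕ) (f : M →ₗ[S] (Fin n → S)), Function.Injective f := by
  let V := LocalizedModule (nonZeroDivisors S) M
  let b := Module.finBasis (FractionRing S) V
  have hfp : Module.FinitePresentation S M := Module.finitePresentation_of_finite S M
  let g : Fin (Module.finrank (FractionRing S) V) → M →ₗ[S] FractionRing S := fun j =>
    ((b.coord j).restrictScalars S) ∘ₗ LocalizedModule.mkLinearMap (nonZeroDivisors S) M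
  choose h s hs using fun j => Module.FinitePresentation.exists_lift_of_isLocalizedModule
    (nonZeroDivisors S) (Algebra.linearMap S (FractionRing S)) (g j)
  refine ⟨_, LinearMap.pi h, ?_⟩
  rw [injective_iff_map_eq_zero]
  intro x hx
  have hg : ∀ j, b.coord j (LocalizedModule.mkLinearMap (nonZeroDivisors S) M x) = 0 := by
    intro j
    have hj : h j x = 0 := congrFun hx j
    have := LinearMap.congr_fun (hs j) x
    rw [LinearMap.comp_apply, hj, map_zero, LinearMap.smul_apply] at this
    exact (smul_eq_zero_iff_right (nonZeroDivisors.coe_ne_zero (s j))).mp this.symm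
  have hV : LocalizedModule.mkLinearMap (nonZeroDivisors S) M x = 0 := b.ext_elem fun j => by
    rw [map_zero]; exact hg j
  obtain ⟨t, ht⟩ := (IsLocalizedModule.eq_zero_iff (nonZeroDivisors S) _).mp hV
  exact (smul_eq_zero_iff_right (nonZeroDivisors.coe_ne_zero t)).mp ht

section DegreeGrowth

open MvPolynomial

variable {σ k ι A : Type*} [CommRing k] [CommRing A] [Algebra (MvPolynomial σ k) A] [Fintype ι]

/-- The linear combinations of the family `e` with polynomial coefficients of degree at most
`n`. -/
def spanDegreeLE (e : ι → A) (n : ℕ) : Set A :=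
  {z | ∃ r : ι → MvPolynomial σ k, (∀ i, (r i).totalDegree ≤ n) ∧ ∑ i, r i • e i = z}

variable {e : ι → A} (he : Submodule.span (MvPolynomial σ k) (Set.range e) = ⊤)

include he

theorem exists_mem_spanDegreeLE (z : A) : ∃ n, z ∈ spanDegreeLE (k := k) (σ := σ) e n := by
  obtain ⟨r, hr⟩ := (Submodule.mem_span_range_iff_exists_fun (MvPolynomial σ k)).mp
    (he ▸ Submodule.mem_top : z ∈ Submodule.span (MvPolynomial σ k) (Set.range e))
  exact ⟨Finset.univ.sup fun i => (r i).totalDegree, r,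
    fun i => Finset.le_sup (f := fun i => (r i).totalDegree) (Finset.mem_univ i), hr⟩

theorem exists_forall_mul_mem_spanDegreeLE (s : A) :
    ∃ c, ∀ n, ∀ z ∈ spanDegreeLE (k := k) (σ := σ) e n,
      s * z ∈ spanDegreeLE (k := k) (σ := σ) e (n + c) := by
  choose c r hr hrs using fun i => exists_mem_spanDegreeLE (k := k) (σ := σ) he (s * e i)
  refine ⟨Finset.univ.sup c, ?_⟩
  rintro n _ ⟨t, ht, rfl⟩
  refine ⟨fun j => ∑ i, t i * r i j, fun j => ?_, ?_⟩
  · refine totalDegree_finsetSum_le fun i _ => (totalDegree_mul _ _).trans ?_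
    exact add_le_add (ht i) ((hr i j).trans (Finset.le_sup (Finset.mem_univ i)))
  · simp only [Finset.sum_smul, Finset.mul_sum, mul_smul_comm, ← hrs, Finset.smul_sum, mul_smul]
    exact Finset.sum_comm

theorem exists_forall_pow_mul_mem_spanDegreeLE (s : A) :
    ∃ c, ∀ b n, ∀ z ∈ spanDegreeLE (k := k) (σ := σ) e n,
      s ^ b * z ∈ spanDegreeLE (k := k) (σ := σ) e (n + c * b) := by
  obtain ⟨c, hc⟩ := exists_forall_mul_mem_spanDegreeLE (k := k) (σ := σ) he s
  refine ⟨c, fun b n z hz => ?_⟩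
  induction b with
  | zero => simpa using hz
  | succ b ih =>
    rw [pow_succ', mul_assoc, mul_add, mul_one, ← add_assoc]
    exact hc _ _ ih

omit he in
theorem spanDegreeLE_mono (e : ι → A) : Monotone (spanDegreeLE (k := k) (σ := σ) e) := by
  rintro n n' h _ ⟨r, hr, rfl⟩
  exact ⟨r, fun i => (hr i).trans h, rfl⟩

theorem exists_forall_prod_pow_mul_mem_spanDegreeLE {κ : Type*} (g : κ → A) (t : Finset κ) :
    ∃ c, ∀ q (b : κ → ℕ), (∀ j, b j ≤ q) → ∀ n, ∀ z ∈ spanDegreeLE (k := k) (σ := σ) e n,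
      (∏ j ∈ t, g j ^ b j) * z ∈ spanDegreeLE (k := k) (σ := σ) e (n + c * q) := by
  classical
  induction t using Finset.induction_on with
  | empty => exact ⟨0, fun q b _ n z hz => by simpa using hz⟩
  | insert j t hj ih =>
    obtain ⟨c, hc⟩ := ih
    obtain ⟨c', hc'⟩ := exists_forall_pow_mul_mem_spanDegreeLE (k := k) (σ := σ) he (g j)
    refine ⟨c + c', fun q b hb n z hz => ?_⟩
    rw [Finset.prod_insert hj, mul_assoc]
    refine spanDegreeLE_mono e ?_ (hc' (b j) _ _ (hc q b hb n z hz))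
    rw [add_mul, ← add_assoc]
    exact Nat.add_le_add_left (Nat.mul_le_mul_left c' (hb j)) _

theorem exists_forall_totalDegree_le {κ : Type*} [Fintype κ] (g : κ → A)
    (φ : A →ₗ[MvPolynomial σ k] MvPolynomial σ k) :
    ∃ c, ∀ q, q ≠ 0 → ∀ b : κ → ℕ, (∀ j, b j ≤ q) → ∀ i,
      (φ (e i ^ q * ∏ j, g j ^ b j)).totalDegree ≤ c * q := by
  obtain ⟨c₁, h₁⟩ := exists_mem_spanDegreeLE (k := k) (σ := σ) he 1
  obtain ⟨c₂, h₂⟩ := exists_forall_prod_pow_mul_mem_spanDegreeLE (k := k) (σ := σ) he g .univ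
  choose c₃ h₃ using fun i => exists_forall_pow_mul_mem_spanDegreeLE (k := k) (σ := σ) he (e i)
  let c₄ := Finset.univ.sup fun i => (φ (e i)).totalDegree
  refine ⟨c₁ + c₂ + Finset.univ.sup c₃ + c₄, fun q hq b hb i => ?_⟩
  obtain ⟨r, hr, hrs⟩ := h₃ i q _ _ (h₂ q b hb _ _ h₁)
  rw [mul_one] at hrs
  rw [← hrs, map_sum]
  refine totalDegree_finsetSum_le fun l _ => ?_
  rw [map_smul, smul_eq_mul]
  refine (totalDegree_mul _ _).trans ((add_le_add (hr l)
    (Finset.le_sup (f := fun i => (φ (e i)).totalDegree) (Finset.mem_univ l))).trans ?_)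
  have hq1 : 1 ≤ q := Nat.one_le_iff_ne_zero.mpr hq
  have hc₃ : c₃ i ≤ Finset.univ.sup c₃ := Finset.le_sup (Finset.mem_univ i)
  simp only [add_mul]
  exact add_le_add (add_le_add (add_le_add (Nat.le_mul_of_pos_right _ hq1) le_rfl)
    (Nat.mul_le_mul_right q hc₃)) (Nat.le_mul_of_pos_right _ hq1)

end DegreeGrowth

section PowKernel

variable {G : Type*} [Monoid G] {m : ℕ}

/-- The `p`-kernel of a set `X` with respect to the family `γ`, as a set of subsets. -/
def powKernel (p : ℕ) (γ : Fin m → G) (X : Set G) : Set (Set G) :=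
  {T | ∃ (a : ℕ) (b : Fin m → ℕ), (∀ j, b j < p ^ a) ∧
    T = {M | M ^ p ^ a * (List.ofFn fun j => γ j ^ b j).prod ∈ X}}

theorem finite_powKernel_setOf_forall {p : ℕ} {γ : Fin m → G} {ι : Type*} [Finite ι]
    {Q : ι → G → Prop} (h : ∀ i, (powKernel p γ {N | Q i N}).Finite) :
    (powKernel p γ {N | ∀ i, Q i N}).Finite := by
  refine ((Set.Finite.pi' h).image fun T => ⋂ i, T i).subset ?_
  rintro _ ⟨a, b, hb, rfl⟩
  refine ⟨fun i => {M | M ^ p ^ a * (List.ofFn fun j => γ j ^ b j).prod ∈ {N | Q i N}},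
    fun i => ⟨a, b, hb, rfl⟩, ?_⟩
  ext M
  simp

open MvPolynomial in
theorem finite_powKernel_linear {p : ℕ} [Fact p.Prime] {σ A : Type*} [Finite σ] [CommRing A]
    [Algebra (MvPolynomial σ (ZMod p)) A] [Module.Finite (MvPolynomial σ (ZMod p)) A]
    (u : G →* A) (φ : A →ₗ[MvPolynomial σ (ZMod p)] MvPolynomial σ (ZMod p)) (γ : Fin m → G) :
    (powKernel p γ {N | φ (u N) = 0}).Finite := by
  obtain ⟨n, e, he⟩ := Module.Finite.exists_fin (R := MvPolynomial σ (ZMod p)) (M := A)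
  obtain ⟨c, hc⟩ := exists_forall_totalDegree_le he (fun j => u (γ j)) φ
  have hexp : ExpChar A p ∨ Subsingleton A := by
    rcases subsingleton_or_nontrivial A with h | h
    · exact .inr h
    · have := charP_of_injective_ringHom
        ((algebraMap (MvPolynomial σ (ZMod p)) A).comp C).injective p
      exact .inl (.prime Fact.out)
  rcases hexp with hexp | hsub
  swap
  · refine (Set.finite_singleton Set.univ).subset ?_
    rintro _ ⟨a, b, -, rfl⟩
    exact Set.eq_univ_of_forall fun M => by
      rw [Set.mem_ofPred, Set.mem_ofPred, Subsingleton.elim (u _) 0, map_zero]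
  choose x hx using fun M => (Submodule.mem_span_range_iff_exists_fun
    (MvPolynomial σ (ZMod p))).mp (he ▸ Submodule.mem_top : u M ∈ Submodule.span _ (Set.range e))
  have hfin : {w : Fin n → MvPolynomial σ (ZMod p) | ∀ i, (w i).totalDegree ≤ c}.Finite :=
    Set.Finite.pi' fun _ => finite_totalDegree_le c
  refine (hfin.finite_subsets.image fun W => {M | ∀ w ∈ W, ∑ i, x M i * w i = 0}).subset ?_
  rintro _ ⟨a, b, hb, rfl⟩
  have hq : p ^ a ≠ 0 := pow_ne_zero _ (Fact.out : p.Prime).ne_zero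
  let v i := φ (e i ^ p ^ a * ∏ j, u (γ j) ^ b j)
  refine ⟨{w | ∃ ε : σ →₀ ℕ, (∀ i, ε i < p ^ a) ∧ (fun i => cartier (p ^ a) hq ε (v i)) = w},
    ?_, ?_⟩
  · rintro _ ⟨ε, -, rfl⟩ i
    exact totalDegree_cartier_le hq (hc _ hq b (fun j => (hb j).le) i) ε
  · ext M
    have hM : φ (u (M ^ p ^ a * (List.ofFn fun j => γ j ^ b j).prod)) =
        ∑ i, x M i ^ p ^ a * v i := by
      rw [map_mul, map_pow, ← hx M, sum_pow_char_pow, map_list_prod, List.map_ofFn,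
        List.prod_ofFn, Finset.sum_mul, map_sum]
      refine Finset.sum_congr rfl fun i _ => ?_
      rw [smul_pow, smul_mul_assoc, map_smul, smul_eq_mul]
      simp [v]
    simp only [Set.mem_ofPred, hM, sum_pow_mul_eq_zero_iff a (x M) v hq]
    aesop

end PowKernel

section IsFiniteCoefficient

universe u

open scoped TensorProduct

variable {G : Type*} [Monoid G] (S : Type*) [CommRing S] {R : Type u} [CommRing R] [Algebra S R]

/-- A function on `G` that factors as a monoid homomorphism to a commutative algebra, finite over
`S`, followed by an `S`-linear map. -/
def IsFiniteCoefficient (f : G → R) : Prop :=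
  ∃ (A : Type u) (_ : CommRing A) (_ : Algebra S A) (_ : Module.Finite S A) (ρ : G →* A)
    (φ : A →ₗ[S] R), ∀ M, f M = φ (ρ M)

namespace IsFiniteCoefficient

variable {S}

theorem const [Module.Finite S R] (c : R) : IsFiniteCoefficient S fun _ : G => c :=
  ⟨R, inferInstance, inferInstance, inferInstance, 1, LinearMap.mulLeft S c, fun M => by simp⟩

theorem add {f g : G → R} (hf : IsFiniteCoefficient S f) (hg : IsFiniteCoefficient S g) :
    IsFiniteCoefficient S fun M => f M + g M := by
  obtain ⟨A, _, _, _, ρ, φ, h⟩ := hf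
  obtain ⟨B, _, _, _, τ, ψ, h'⟩ := hg
  exact ⟨A × B, inferInstance, inferInstance, inferInstance, ρ.prod τ, φ.coprod ψ,
    fun M => by simp [h, h']⟩

theorem mul {f g : G → R} (hf : IsFiniteCoefficient S f) (hg : IsFiniteCoefficient S g) :
    IsFiniteCoefficient S fun M => f M * g M := by
  obtain ⟨A, _, _, _, ρ, φ, h⟩ := hf
  obtain ⟨B, _, _, _, τ, ψ, h'⟩ := hg
  exact ⟨A ⊗[S] B, inferInstance, inferInstance, inferInstance,
    { toFun := fun M => ρ M ⊗ₜ τ M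
      map_one' := by rw [map_one, map_one, Algebra.TensorProduct.one_def]
      map_mul' := fun M N => by rw [map_mul, map_mul, Algebra.TensorProduct.tmul_mul_tmul] },
    LinearMap.mul' S R ∘ₗ TensorProduct.map φ ψ, fun M => by simp [h, h']⟩

theorem mvPolynomial_eval [Module.Finite S R] {τ : Type*} {f : τ → G → R}
    (hf : ∀ t, IsFiniteCoefficient S (f t)) (P : MvPolynomial τ R) :
    IsFiniteCoefficient S fun M => MvPolynomial.eval (fun t => f t M) P := by
  induction P using MvPolynomial.induction_on with
  | C c => simpa using const c
  | add P Q hP hQ => simpa using hP.add hQ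
  | mul_X P t hP => simpa using hP.mul (hf t)

open scoped IsMulCommutative in
theorem matrix_entry {n : Type} [Fintype n] [DecidableEq n] [IsNoetherianRing S]
    [Module.Finite S R] (ρ : G →* Matrix n n R) (hρ : ∀ M N, ρ M * ρ N = ρ N * ρ M) (i j : n) :
    IsFiniteCoefficient S fun M => ρ M i j := by
  obtain ⟨B, hB⟩ : ∃ B, B = Algebra.adjoin S (Set.range ρ) := ⟨_, rfl⟩
  have : IsMulCommutative B := by
    rw [hB]
    refine Algebra.isMulCommutative_adjoin S ?_
    rintro _ ⟨M, rfl⟩ _ ⟨N, rfl⟩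
    exact hρ M N
  have : Module.Finite S (Matrix n n R) := inferInstanceAs (Module.Finite S (n → n → R))
  have : IsNoetherian S (Matrix n n R) := isNoetherian_of_isNoetherianRing_of_finite S _
  have : Module.Finite S B := inferInstanceAs (Module.Finite S (Subalgebra.toSubmodule B))
  refine ⟨B, inferInstance, inferInstance, this,
    ρ.codRestrict B fun M => hB ▸ Algebra.subset_adjoin ⟨M, rfl⟩,
    Matrix.entryLinearMap S R i j ∘ₗ B.val.toLinearMap, fun M => rfl⟩

open MvPolynomial in
theorem finite_powKernel {p : ℕ} [Fact p.Prime] {σ : Type*} [Finite σ] [IsDomain R]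
    [Algebra (MvPolynomial σ (ZMod p)) R] [Module.Finite (MvPolynomial σ (ZMod p)) R]
    [Module.IsTorsionFree (MvPolynomial σ (ZMod p)) R] {m : ℕ} (γ : Fin m → G)
    {f : G → R} (hf : IsFiniteCoefficient (MvPolynomial σ (ZMod p)) f) :
    (powKernel p γ {N | f N = 0}).Finite := by
  obtain ⟨A, _, _, _, ρ, φ, h⟩ := hf
  obtain ⟨n, ψ, hψ⟩ := exists_injective_to_pi (MvPolynomial σ (ZMod p)) R
  have hf0 : ∀ N, f N = 0 ↔ ∀ i, (LinearMap.proj i ∘ₗ ψ ∘ₗ φ) (ρ N) = 0 := fun N => by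
    rw [h, ← map_eq_zero_iff ψ hψ]
    exact funext_iff
  simp only [hf0]
  exact finite_powKernel_setOf_forall fun i => finite_powKernel_linear ρ _ γ

end IsFiniteCoefficient

end IsFiniteCoefficient

theorem exists_fg_subalgebra_matrix_entries_mem {k K : Type*} [Field k] [Field K] [Algebra k K]
    {n ι κ τ : Type*} [Finite n] [Finite ι] [Finite κ] (N : ι → Matrix n n K)
    (P : κ → MvPolynomial τ K) :
    ∃ R : Subalgebra k K, Algebra.FiniteType k R ∧ (∀ i x y, N i x y ∈ R) ∧
      ∀ l, ∃ Q : MvPolynomial τ R, Q.map (algebraMap R K) = P l := by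
  let F : Set K := (Set.range fun z : ι × n × n => N z.1 z.2.1 z.2.2) ∪ ⋃ l, ((P l).coeffs : Set K)
  have hF : F.Finite := (Set.finite_range _).union (Set.finite_iUnion fun l => Finset.finite_toSet _)
  refine ⟨Algebra.adjoin k F, ?_, fun i x y => ?_, fun l => ?_⟩
  · exact (Subalgebra.fg_iff_finiteType _).mp (Subalgebra.fg_def.mpr ⟨F, hF, rfl⟩)
  · exact Algebra.subset_adjoin (.inl ⟨(i, x, y), rfl⟩)
  · refine MvPolynomial.mem_range_map_iff_coeffs_subset.mpr fun c hc => ?_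
    exact ⟨⟨c, Algebra.subset_adjoin (.inr (Set.mem_iUnion.mpr ⟨l, hc⟩))⟩, rfl⟩

theorem matrix_entries_mem_of_mem_closure {k K : Type*} [CommRing k] [Field K] [Algebra k K]
    (R : Subalgebra k K) {n ι : Type*} [Fintype n] [DecidableEq n] (γ : ι → GL n K)
    (h : ∀ i x y, (γ i : Matrix n n K) x y ∈ R)
    (h' : ∀ i x y, (↑(γ i)⁻¹ : Matrix n n K) x y ∈ R) :
    ∀ M ∈ Subgroup.closure (Set.range γ), ∀ x y, (M : Matrix n n K) x y ∈ R := by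
  intro M hM
  suffices H : (∀ x y, (M : Matrix n n K) x y ∈ R) ∧ ∀ x y, (↑M⁻¹ : Matrix n n K) x y ∈ R from H.1
  have hmul : ∀ A B : Matrix n n K, (∀ x y, A x y ∈ R) → (∀ x y, B x y ∈ R) →
      ∀ x y, (A * B) x y ∈ R := fun A B hA hB x y =>
    sum_mem fun z _ => mul_mem (hA x z) (hB z y)
  induction hM using Subgroup.closure_induction with
  | mem _ hx =>
    obtain ⟨i, rfl⟩ := hx
    exact ⟨h i, h' i⟩
  | one =>
    have : ∀ x y, (1 : Matrix n n K) x y ∈ R := fun x y => by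
      rw [Matrix.one_apply]
      split_ifs <;> simp
    simpa using this
  | mul A B _ _ hA hB =>
    refine ⟨?_, ?_⟩
    · rw [Units.val_mul]
      exact hmul _ _ hA.1 hB.1
    · rw [_root_.mul_inv_rev, Units.val_mul]
      exact hmul _ _ hB.2 hA.2
  | inv A _ hA => exact ⟨hA.2, by rw [inv_inv]; exact hA.1⟩

theorem finite_powKernel_matrix_of_finite {p : ℕ} [Fact p.Prime] {G R σ : Type*} [Monoid G]
    [CommRing R] [IsDomain R] [Finite σ] [Algebra (MvPolynomial σ (ZMod p)) R]
    [Module.Finite (MvPolynomial σ (ZMod p)) R]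
    [Module.IsTorsionFree (MvPolynomial σ (ZMod p)) R] {n : Type} [Fintype n] [DecidableEq n]
    {m : ℕ} {ι : Type*} [Finite ι] (ρ : G →* Matrix n n R)
    (hρ : ∀ M N, ρ M * ρ N = ρ N * ρ M) (Q : ι → MvPolynomial (n × n) R) (γ : Fin m → G) :
    (powKernel p γ {N | ∀ i,
      MvPolynomial.eval (fun q : n × n => ρ N q.1 q.2) (Q i) = 0}).Finite := by
  have : IsNoetherianRing (MvPolynomial σ (ZMod p)) := MvPolynomial.isNoetherianRing
  have hf : ∀ q : n × n, IsFiniteCoefficient (MvPolynomial σ (ZMod p)) fun N => ρ N q.1 q.2 :=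
    fun q => IsFiniteCoefficient.matrix_entry ρ hρ q.1 q.2
  have hQ k := IsFiniteCoefficient.mvPolynomial_eval hf (Q k)
  exact finite_powKernel_setOf_forall fun k => (hQ k).finite_powKernel γ

theorem finite_powKernel_matrix {p : ℕ} [Fact p.Prime] {G R : Type*} [Monoid G] [CommRing R]
    [IsDomain R] [Algebra (ZMod p) R] [Algebra.FiniteType (ZMod p) R] {d m : ℕ} {ι : Type*}
    [Finite ι] (ρ : G →* Matrix (Fin d) (Fin d) R) (hρ : ∀ M N, ρ M * ρ N = ρ N * ρ M)
    (Q : ι → MvPolynomial (Fin d × Fin d) R) (γ : Fin m → G) :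
    (powKernel p γ {N | ∀ i,
      MvPolynomial.eval (fun q : Fin d × Fin d => ρ N q.1 q.2) (Q i) = 0}).Finite := by
  obtain ⟨s, g, hg, hgfin⟩ := exists_finite_inj_algHom_of_fg (ZMod p) R
  let _ : Algebra (MvPolynomial (Fin s) (ZMod p)) R := g.toRingHom.toAlgebra
  have : Module.Finite (MvPolynomial (Fin s) (ZMod p)) R := hgfin
  have : Module.IsTorsionFree (MvPolynomial (Fin s) (ZMod p)) R :=
    Module.isTorsionFree_iff_algebraMap_injective.mpr hg
  exact finite_powKernel_matrix_of_finite (σ := Fin s) ρ hρ Q γ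

/-- Mordell–Lang type result: if `X` is a Zariski closed subset of
`GL_d(K)` (cut out by polynomials `P_1,…,P_r` in the matrix entries) and `Γ` is a
finitely generated commutative subgroup of `GL_d(K)`, with `K` of characteristic
`p`, then `X ∩ Γ` is a `p`-automatic subset of `Γ`. -/
theorem zariski_closed_inter_fg_abelian_subgroup_automatic
    (p : ℕ) (hp : p.Prime) (K : Type*) [Field K] [CharP K p]
    (d : ℕ) (hd : 0 < d)
    (r : ℕ) (P : Fin r → MvPolynomial (Fin d × Fin d) K)
    (Γ : Subgroup (GL (Fin d) K))
    (hcomm : ∀ x ∈ Γ, ∀ y ∈ Γ, x * y = y * x)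
    (hFG : Group.FG ↥Γ) :
    ∀ (m : ℕ) (γ : Fin m → ↥Γ),
      Subgroup.closure (Set.range γ) = ⊤ →
      Set.Finite { T : Set ↥Γ |
        ∃ (a : ℕ) (b : Fin m → ℕ), (∀ j, b j < p ^ a) ∧
          T = { M : ↥Γ |
            M ^ (p ^ a) * (List.ofFn fun j : Fin m => γ j ^ b j).prod ∈
              { N : ↥Γ | ∀ k : Fin r,
                MvPolynomial.eval
                  (fun q : Fin d × Fin d =>
                    ((N : GL (Fin d) K) : Matrix (Fin d) (Fin d) K) q.1 q.2)
                  (P k) = 0 } } } := by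
  intro m γ hγ
  have : Fact p.Prime := ⟨hp⟩
  let _ : Algebra (ZMod p) K := ZMod.algebra K p
  obtain ⟨R, hR, hmem, hP⟩ := exists_fg_subalgebra_matrix_entries_mem (k := ZMod p)
    (Sum.elim (fun j => ((γ j : GL (Fin d) K) : Matrix (Fin d) (Fin d) K))
      fun j => (((γ j : GL (Fin d) K)⁻¹ : GL (Fin d) K) : Matrix (Fin d) (Fin d) K)) P
  choose Q hQ using hP
  have hΓ : ∀ (M : Γ) x y, ((M : GL (Fin d) K) : Matrix (Fin d) (Fin d) K) x y ∈ R := by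
    intro M
    refine matrix_entries_mem_of_mem_closure R (fun j => (γ j : GL (Fin d) K))
      (fun j => hmem (.inl j)) (fun j => hmem (.inr j)) _ ?_
    have hM : M ∈ Subgroup.closure (Set.range γ) := hγ ▸ Subgroup.mem_top M
    have := Subgroup.mem_map_of_mem Γ.subtype hM
    rw [MonoidHom.map_closure, ← Set.range_comp] at this
    exact this
  let ρ : Γ →* Matrix (Fin d) (Fin d) R :=
    { toFun := fun M => Matrix.of fun x y => ⟨_, hΓ M x y⟩
      map_one' := by
        ext x y
        simp [Matrix.one_apply, apply_ite]
      map_mul' := fun M N => by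
        ext x y
        simp [Matrix.mul_apply] }
  have hρ : ∀ M N, ρ M * ρ N = ρ N * ρ M := fun M N => by
    rw [← map_mul, ← map_mul]
    exact congrArg ρ (Subtype.ext (hcomm M M.2 N N.2))
  have heval : ∀ (N : Γ) k, MvPolynomial.eval (fun q : Fin d × Fin d =>
      ((N : GL (Fin d) K) : Matrix (Fin d) (Fin d) K) q.1 q.2) (P k) = 0 ↔
      MvPolynomial.eval (fun q : Fin d × Fin d => ρ N q.1 q.2) (Q k) = 0 := fun N k => by
    have h : algebraMap R K (MvPolynomial.eval (fun q : Fin d × Fin d => ρ N q.1 q.2) (Q k)) =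
        MvPolynomial.eval (fun q : Fin d × Fin d =>
          ((N : GL (Fin d) K) : Matrix (Fin d) (Fin d) K) q.1 q.2) (P k) := by
      rw [← hQ k, MvPolynomial.eval_map]
      exact MvPolynomial.eval₂_comp_left (algebraMap R K) (RingHom.id R) _ (Q k)
    rw [← h, map_eq_zero_iff (algebraMap R K) Subtype.val_injective]
  simp only [heval]
  exact finite_powKernel_matrix ρ hρ Q γ
end

section
/- Let k ≥ 2 be an integer, Γ a finitely generated abelian group (written additively), and Δ a finite set. Suppose f : Γ → Δ has a finite k-kernel with respect to some finite generating family γ_1,…,γ_d of Γ. Then f has a finite k-kernel with respect to every finite generating family of Γ (i.e., f is k-automatic). -/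
/-- if a map `f` from a finitely generated abelian group `Γ` to a
finite set `Δ` has a finite `k`-kernel with respect to some finite generating
family, then its `k`-kernel with respect to every finite generating family is
finite. -/
theorem kernel_finite_independent_of_generating_family
    (k : ℕ) (hk : 2 ≤ k)
    (Γ : Type*) [AddCommGroup Γ] (Δ : Type*) [Finite Δ]
    (f : Γ → Δ)
    (d : ℕ) (γ : Fin d → Γ)
    (hγ : AddSubgroup.closure (Set.range γ) = ⊤)
    (hker : Set.Finite { g : Γ → Δ |
      ∃ (a : ℕ) (b : Fin d → ℕ), (∀ i, b i < k ^ a) ∧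
        g = fun x => f (k ^ a • x + ∑ i : Fin d, b i • γ i) }) :
    ∀ (e : ℕ) (δ : Fin e → Γ),
      AddSubgroup.closure (Set.range δ) = ⊤ →
      Set.Finite { g : Γ → Δ |
        ∃ (a : ℕ) (b : Fin e → ℕ), (∀ i, b i < k ^ a) ∧
          g = fun x => f (k ^ a • x + ∑ i : Fin e, b i • δ i) } := by
  have hspan : Submodule.span ℤ (Set.range γ) = ⊤ := by
    rw [← Submodule.toAddSubgroup_inj, Submodule.span_int_eq_addSubgroupClosure, hγ]
    rfl
  intro e δ _
  have hm : ∀ j, ∃ m : Fin d → ℤ, ∑ i, m i • γ i = δ j := fun j =>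
    (Submodule.mem_span_range_iff_exists_fun ℤ).1 (hspan ▸ Submodule.mem_top)
  choose m hm using hm
  let M : Fin d → ℤ := fun i => ∑ j, |m j i|
  refine (hker.image2 (fun g (q : Fin d → ℤ) x => g (x + ∑ i, q i • γ i))
    (Set.finite_Icc (-M) M)).subset ?_
  rintro _ ⟨a, b, hb, rfl⟩
  have hK : (0 : ℤ) < (k : ℤ) ^ a := by positivity
  let c : Fin d → ℤ := fun i => ∑ j, (b j : ℤ) * m j i
  have hc : ∀ i, |c i| ≤ (k : ℤ) ^ a * M i := fun i => by
    refine (Finset.abs_sum_le_sum_abs _ _).trans ?_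
    rw [Finset.mul_sum]
    refine Finset.sum_le_sum fun j _ => ?_
    rw [abs_mul, Nat.abs_cast]
    gcongr
    exact_mod_cast (hb j).le
  have hsum : ∑ j, b j • δ j = ∑ i, c i • γ i := by
    simp only [c, Finset.sum_smul, ← hm, Finset.smul_sum, mul_smul, natCast_zsmul]
    exact Finset.sum_comm
  have hr : ∀ i, (((c i % (k : ℤ) ^ a).toNat : ℕ) : ℤ) = c i % (k : ℤ) ^ a := fun i =>
    Int.toNat_of_nonneg (Int.emod_nonneg _ hK.ne')
  refine ⟨_, ⟨a, fun i => (c i % (k : ℤ) ^ a).toNat, fun i => ?_, rfl⟩,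
    fun i => c i / (k : ℤ) ^ a, ⟨fun i => ?_, fun i => ?_⟩, ?_⟩
  · have := Int.emod_lt_of_pos (c i) hK
    rw [← hr] at this
    exact_mod_cast this
  · refine (Int.le_ediv_iff_mul_le hK).2 ?_
    have := (abs_le.1 (hc i)).1
    simp only [Pi.neg_apply]
    linarith
  · refine Int.ediv_le_of_le_mul hK ?_
    have := (abs_le.1 (hc i)).2
    linarith
  · funext x
    refine congrArg f ?_
    rw [hsum, smul_add, add_assoc, Finset.smul_sum, ← Finset.sum_add_distrib]
    refine congrArg _ (Finset.sum_congr rfl fun i _ => ?_)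
    rw [← natCast_zsmul _ (k ^ a), ← natCast_zsmul _ (Int.toNat _), hr, ← mul_smul, ← add_smul,
      Nat.cast_pow, Int.mul_ediv_add_emod]
end

section
/- Let k ≥ 2 be an integer, let Γ_1 and Γ_2 be finitely generated abelian groups, and let Φ : Γ_1 → Γ_2 be a surjective group homomorphism. If S is a k-automatic subset of Γ_2, then Φ^{-1}(S) is a k-automatic subset of Γ_1. -/
/-- the preimage of a `k`-automatic subset of a finitely generated
abelian group under a surjective group homomorphism of finitely generated
abelian groups is `k`-automatic. -/
theorem preimage_of_automatic_subset_automatic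
    (k : ℕ) (hk : 2 ≤ k)
    (Γ₁ Γ₂ : Type*) [AddCommGroup Γ₁] [AddCommGroup Γ₂]
    [AddGroup.FG Γ₁] [AddGroup.FG Γ₂]
    (Φ : Γ₁ →+ Γ₂) (hΦ : Function.Surjective Φ)
    (S : Set Γ₂)
    (hS : ∀ (d : ℕ) (γ : Fin d → Γ₂),
      AddSubgroup.closure (Set.range γ) = ⊤ →
      Set.Finite { T : Set Γ₂ |
        ∃ (a : ℕ) (b : Fin d → ℕ), (∀ i, b i < k ^ a) ∧
          T = { x : Γ₂ | k ^ a • x + ∑ i : Fin d, b i • γ i ∈ S } }) :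
    ∀ (d : ℕ) (γ : Fin d → Γ₁),
      AddSubgroup.closure (Set.range γ) = ⊤ →
      Set.Finite { T : Set Γ₁ |
        ∃ (a : ℕ) (b : Fin d → ℕ), (∀ i, b i < k ^ a) ∧
          T = { x : Γ₁ | k ^ a • x + ∑ i : Fin d, b i • γ i ∈ Φ ⁻¹' S } } := by
  intro d γ hγ
  have hgen : AddSubgroup.closure (Set.range (Φ ∘ γ)) = ⊤ := by
    rw [Set.range_comp, ← AddMonoidHom.map_closure, hγ,
      AddSubgroup.map_top_of_surjective Φ hΦ]
  refine ((hS d (Φ ∘ γ) hgen).image (Φ ⁻¹' ·)).subset ?_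
  rintro _ ⟨a, b, hb, rfl⟩
  refine ⟨_, ⟨a, b, hb, rfl⟩, ?_⟩
  ext x
  simp
end

section
/- Let k ≥ 2 be an integer, d a positive integer, and Δ a finite set. For a map f : ℤ^d → Δ, the following are equivalent: (a) the k-kernel of f, namely the collection of maps ℤ^d → Δ of the form (n_1,…,n_d) ↦ f(k^a n_1 + b_1, …, k^a n_d + b_d) with a ∈ ℕ and 0 ≤ b_1,…,b_d < k^a, is finite; (b) for every sign vector ε = (ε_1,…,ε_d) ∈ {±1}^d, the map f_ε : ℕ^d → Δ defined by f_ε(n_1,…,n_d) = f(ε_1 n_1,…,ε_d n_d) has a finite k-kernel, namely the collection of maps ℕ^d → Δ of the form (n_1,…,n_d) ↦ f_ε(k^a n_1 + b_1, …, k^a n_d + b_d) with a ∈ ℕ and 0 ≤ b_1,…,b_d < k^a is finite. -/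
/-- The residue modulo `q` of `-b`, for `b < q`. -/
def negResidue (q b : ℕ) : ℕ := if b = 0 then 0 else q - b

lemma negResidue_lt {q b : ℕ} (h : b < q) : negResidue q b < q := by
  unfold negResidue
  split_ifs <;> omega

/-- The carry `1` or `0` produced when negating an integer with residue `b`. -/
def negCarry (b : ℕ) : Bool := decide (b ≠ 0)

lemma neg_mul_add_eq {q b : ℕ} (h : b < q) (n : ℤ) :
    -((q : ℤ) * n + b) = q * (-n - (negCarry b).toNat) + negResidue q b := by
  unfold negResidue negCarry
  by_cases hb : b = 0
  · simp [hb]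
  · simp only [hb, if_false, ne_eq, not_false_eq_true, decide_true, Bool.toNat_true]
    push_cast [h.le]
    ring

lemma mul_add_eq_neg {q b : ℕ} (h : b < q) {n : ℤ} (hn : n < 0) :
    (q : ℤ) * n + b =
      -(((q * (-n - (negCarry b).toNat).toNat + negResidue q b : ℕ)) : ℤ) := by
  have hc : ((negCarry b).toNat : ℤ) ≤ 1 := by exact_mod_cast Bool.toNat_le _
  push_cast
  rw [Int.toNat_of_nonneg (by omega), ← neg_mul_add_eq h, neg_neg]


/-- a map `f : ℤ^d → Δ` has a finite `k`-kernel iff for every sign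
vector `ε ∈ {±1}^d` the map `f_ε : ℕ^d → Δ`, `n ↦ f(ε·n)`, has a finite
`k`-kernel. -/
theorem int_kernel_finite_iff_restrictions_kernel_finite
    (k : ℕ) (hk : 2 ≤ k) (d : ℕ) (hd : 0 < d)
    (Δ : Type*) [Finite Δ]
    (f : (Fin d → ℤ) → Δ) :
    Set.Finite { g : (Fin d → ℤ) → Δ |
      ∃ (a : ℕ) (b : Fin d → ℕ), (∀ i, b i < k ^ a) ∧
        g = fun n => f (fun i => (k : ℤ) ^ a * n i + (b i : ℤ)) }
    ↔ ∀ ε : Fin d → ℤ, (∀ i, ε i = 1 ∨ ε i = -1) →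
      Set.Finite { g : (Fin d → ℕ) → Δ |
        ∃ (a : ℕ) (b : Fin d → ℕ), (∀ i, b i < k ^ a) ∧
          g = fun n => f (fun i => ε i * ((k ^ a * n i + b i : ℕ) : ℤ)) } := by
  constructor
  · intro hfin ε hε
    refine (hfin.image2 (fun g (e : Fin d → Bool) (n : Fin d → ℕ) =>
      g (fun i => if ε i = 1 then (n i : ℤ) else -(n i : ℤ) - (e i).toNat))
      Set.finite_univ).subset ?_
    rintro _ ⟨a, b, hb, rfl⟩
    refine ⟨_, ⟨a, fun i => if ε i = 1 then b i else negResidue (k ^ a) (b i), fun i => ?_, rfl⟩,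
      fun i => negCarry (b i), Set.mem_univ _, ?_⟩
    · dsimp only
      split_ifs
      exacts [hb i, negResidue_lt (hb i)]
    · funext n
      dsimp only
      congr 1
      funext i
      rcases hε i with h | h
      · simp [h]
      · have := neg_mul_add_eq (hb i) (n i)
        push_cast at this
        simp only [h, show ¬ ((-1 : ℤ) = 1) by decide, if_false]
        push_cast
        rw [← this]
        ring
  · intro hfin
    have hpi := Set.Finite.pi' (fun s : Fin d → Bool =>
      hfin (fun i => if s i then 1 else -1) (fun i => by cases s i <;> simp))
    refine (hpi.image2 (fun H (e : Fin d → Bool) (n : Fin d → ℤ) =>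
      H (fun i => decide (0 ≤ n i))
        (fun i => if 0 ≤ n i then (n i).toNat else (-(n i) - (e i).toNat).toNat))
      Set.finite_univ).subset ?_
    rintro _ ⟨a, b, hb, rfl⟩
    refine ⟨_, fun s => ⟨a, fun i => if s i then b i else negResidue (k ^ a) (b i),
      fun i => ?_, rfl⟩, fun i => negCarry (b i), Set.mem_univ _, ?_⟩
    · dsimp only
      split_ifs
      exacts [hb i, negResidue_lt (hb i)]
    · funext n
      dsimp only
      congr 1
      funext i
      by_cases h : 0 ≤ n i
      · simp [h]
      · have := mul_add_eq_neg (hb i) (not_le.mp h)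
        simp only [h, decide_false, Bool.false_eq_true, if_false]
        rw [neg_one_mul, ← this]
        push_cast
        rfl
end

section
/- Let p be a prime number, d and N positive integers. Then the number of p-automatic subsets S ⊆ ℕ^d whose p-complexity is at most N (i.e., whose p-kernel has cardinality at most N) is at most N · 2^N · N^{p^d N}; in particular, the collection of such subsets is finite. -/
/-- The `p`-kernel of a subset of `ℕ^d`. -/
def pKernel (p d : ℕ) (S : Set (Fin d → ℕ)) : Set (Set (Fin d → ℕ)) :=
  { T | ∃ (a : ℕ) (b : Fin d → ℕ), (∀ i, b i < p ^ a) ∧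
      T = { n : Fin d → ℕ | (fun i => p ^ a * n i + b i) ∈ S } }

/-- The digit section `{n | p n + r ∈ T}` of a subset `T` of `ℕ^d`. -/
def digitSection {p d : ℕ} (r : Fin d → Fin p) (T : Set (Fin d → ℕ)) : Set (Fin d → ℕ) :=
  {n | (fun i => p * n i + r i) ∈ T}

theorem self_mem_pKernel (p d : ℕ) (S : Set (Fin d → ℕ)) : S ∈ pKernel p d S :=
  ⟨0, fun _ => 0, by simp, by ext; simp⟩

theorem digitSection_mem_pKernel {p d : ℕ} {S T : Set (Fin d → ℕ)} (hT : T ∈ pKernel p d S)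
    (r : Fin d → Fin p) : digitSection r T ∈ pKernel p d S := by
  obtain ⟨a, b, hb, rfl⟩ := hT
  refine ⟨a + 1, fun i => p ^ a * r i + b i, fun i => ?_, ?_⟩
  · calc p ^ a * r i + b i < p ^ a * r i + p ^ a := Nat.add_lt_add_left (hb i) _
      _ = p ^ a * (r i + 1) := by ring
      _ ≤ p ^ a * p := Nat.mul_le_mul_left _ (r i).isLt
      _ = p ^ (a + 1) := (pow_succ p a).symm
  · ext n
    simp only [digitSection, Set.mem_ofPred_eq]
    have : (fun i => p ^ a * (p * n i + r i) + b i) =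
        fun i => p ^ (a + 1) * n i + (p ^ a * r i + b i) := by
      ext i
      ring
    rw [this]

/-- A family of subsets of `ℕ^d` indexed by the states of an automaton with transitions `δ` and
outputs `out`, each state reading off the membership of its set, least significant digit first. -/
structure IsStateFamily {p d : ℕ} {Q : Type*} (out : Q → Bool) (δ : (Fin d → Fin p) × Q → Q)
    (f : Q → Set (Fin d → ℕ)) : Prop where
  out_iff : ∀ q, out q = true ↔ 0 ∈ f q
  transition : ∀ r q, f (δ (r, q)) = digitSection r (f q)

theorem IsStateFamily.unique {p d : ℕ} (hp : 1 < p) {Q : Type*} {out : Q → Bool}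
    {δ : (Fin d → Fin p) × Q → Q} {f g : Q → Set (Fin d → ℕ)}
    (hf : IsStateFamily out δ f) (hg : IsStateFamily out δ g) : f = g := by
  suffices h : ∀ (s : ℕ) (n : Fin d → ℕ), ∑ i, n i = s → ∀ q, n ∈ f q ↔ n ∈ g q by
    ext q n
    exact h _ n rfl q
  intro s
  induction s using Nat.strong_induction_on with
  | _ s ih =>
    rintro n rfl q
    by_cases hn : n = 0
    · rw [hn, ← hf.out_iff, hg.out_iff]
    obtain ⟨j, hj⟩ := Function.ne_iff.mp hn
    have hlt : ∑ i, n i / p < ∑ i, n i :=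
      Finset.sum_lt_sum (fun i _ => Nat.div_le_self _ _)
        ⟨j, Finset.mem_univ j, Nat.div_lt_self (Nat.pos_of_ne_zero hj) hp⟩
    let r : Fin d → Fin p := fun i => ⟨n i % p, Nat.mod_lt _ (by lia)⟩
    have key := ih _ hlt (fun i => n i / p) rfl (δ (r, q))
    rw [hf.transition, hg.transition] at key
    simpa [digitSection, r, Nat.div_add_mod] using key

theorem exists_isStateFamily {p d N : ℕ} {S : Set (Fin d → ℕ)}
    (hfin : (pKernel p d S).Finite) (hcard : (pKernel p d S).ncard ≤ N) :
    ∃ (q₀ : Fin N) (out : Fin N → Bool) (δ : (Fin d → Fin p) × Fin N → Fin N)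
      (f : Fin N → Set (Fin d → ℕ)), IsStateFamily out δ f ∧ f q₀ = S := by
  classical
  have := hfin.fintype
  have : Nonempty (pKernel p d S) := ⟨⟨S, self_mem_pKernel p d S⟩⟩
  have hle : Fintype.card (pKernel p d S) ≤ Fintype.card (Fin N) := by
    rwa [Fintype.card_fin, ← Nat.card_eq_fintype_card, Nat.card_coe_set_eq]
  obtain ⟨e⟩ := Function.Embedding.nonempty_of_card_le hle
  have hsurj := Function.invFun_surjective e.injective
  set f := Function.invFun e
  choose δ hδ using fun x : (Fin d → Fin p) × Fin N =>
    hsurj ⟨_, digitSection_mem_pKernel (f x.2).2 x.1⟩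
  obtain ⟨q₀, hq₀⟩ := hsurj ⟨S, self_mem_pKernel p d S⟩
  exact ⟨q₀, fun q => decide (0 ∈ (f q : Set (Fin d → ℕ))), δ, fun q => f q,
    ⟨by simp, fun r q => congrArg Subtype.val (hδ (r, q))⟩, congrArg Subtype.val hq₀⟩

/-- there are at most `N · 2^N · N^(p^d · N)` subsets `S ⊆ ℕ^d`
that are `p`-automatic with `p`-complexity (cardinality of the `p`-kernel) at
most `N`; in particular the collection of such subsets is finite. -/
theorem count_automatic_sets_of_bounded_complexity
    (p : ℕ) (hp : p.Prime) (d N : ℕ) (hd : 0 < d) (hN : 0 < N) :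
    Set.Finite { S : Set (Fin d → ℕ) |
        (pKernel p d S).Finite ∧ (pKernel p d S).ncard ≤ N } ∧
    Set.ncard { S : Set (Fin d → ℕ) |
        (pKernel p d S).Finite ∧ (pKernel p d S).ncard ≤ N }
      ≤ N * 2 ^ N * N ^ (p ^ d * N) := by
  set A := { S : Set (Fin d → ℕ) | (pKernel p d S).Finite ∧ (pKernel p d S).ncard ≤ N }
  have : Nonempty (Fin N) := ⟨⟨0, hN⟩⟩
  choose! q₀ out δ f hf hq₀ using
    fun S (hS : S ∈ A) => exists_isStateFamily (N := N) hS.1 hS.2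
  let code : Set (Fin d → ℕ) →
      (Fin N × (Fin N → Bool)) × ((Fin d → Fin p) × Fin N → Fin N) :=
    fun S => ((q₀ S, out S), δ S)
  have hinj : Set.InjOn code A := by
    intro S hS T hT h
    simp only [code, Prod.mk.injEq] at h
    obtain ⟨⟨hq, hout⟩, hδ⟩ := h
    have hfT := hf T hT
    rw [← hout, ← hδ] at hfT
    rw [← hq₀ S hS, ← hq₀ T hT, (hf S hS).unique hp.one_lt hfT, hq]
  refine ⟨Set.Finite.of_injOn (Set.mapsTo_univ code A) hinj Set.finite_univ, ?_⟩
  calc A.ncard ≤ (Set.univ : Set ((Fin N × (Fin N → Bool)) ×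
        ((Fin d → Fin p) × Fin N → Fin N))).ncard :=
      Set.ncard_le_ncard_of_injOn code (fun _ _ => Set.mem_univ _) hinj Set.finite_univ
    _ = N * 2 ^ N * N ^ (p ^ d * N) := by
      simp [Set.ncard_univ, Nat.card_eq_fintype_card]
end

section
/- Let p be a prime number, d a positive integer, and let S ⊆ ℕ^d be a finite p-automatic set. Then every s ∈ S satisfies ‖s‖ ≤ p^{comp_p(S) − 2}, where the right-hand side is interpreted as a rational number (the exponent comp_p(S) − 2 being an integer). -/
/-- The `p`-complexity of a subset of `ℕ^d`: the cardinality of its `p`-kernel. -/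
noncomputable def pComplexity (p d : ℕ) (S : Set (Fin d → ℕ)) : ℕ :=
  (pKernel p d S).ncard

/-- If all coordinates of `S` are bounded, then the empty set lies in the `p`-kernel of `S`. -/
theorem empty_mem_pKernel {p d M : ℕ} (hp : 1 < p) (i : Fin d) {S : Set (Fin d → ℕ)}
    (hM : ∀ s ∈ S, ∀ j, s j ≤ M) : ∅ ∈ pKernel p d S := by
  refine ⟨M + 1, fun _ => M + 1, fun _ => Nat.lt_pow_self hp, ?_⟩
  symm
  rw [Set.eq_empty_iff_forall_notMem]
  intro n hn
  have := hM _ hn i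
  dsimp only at this
  omega

/-- The element of the `p`-kernel of `S` that reads off the last `a` base-`p` digits of `s`. -/
def digitKernel (p d : ℕ) (S : Set (Fin d → ℕ)) (s : Fin d → ℕ) (a : ℕ) : Set (Fin d → ℕ) :=
  { n | (fun i => p ^ a * n i + s i % p ^ a) ∈ S }

theorem digitKernel_mem_pKernel {p d : ℕ} (hp : 0 < p) (S : Set (Fin d → ℕ)) (s : Fin d → ℕ)
    (a : ℕ) : digitKernel p d S s a ∈ pKernel p d S :=
  ⟨a, fun i => s i % p ^ a, fun _ => Nat.mod_lt _ (pow_pos hp a), rfl⟩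

theorem div_mem_digitKernel (p : ℕ) {d : ℕ} {S : Set (Fin d → ℕ)} {s : Fin d → ℕ} (hs : s ∈ S)
    (a : ℕ) : (fun i => s i / p ^ a) ∈ digitKernel p d S s a := by
  simpa [digitKernel, Nat.div_add_mod] using hs

theorem le_div_of_mem_digitKernel {p d M : ℕ} (hp : 0 < p) {S : Set (Fin d → ℕ)}
    {s : Fin d → ℕ} (hM : ∀ t ∈ S, ∀ j, t j ≤ M) {a : ℕ} {n : Fin d → ℕ}
    (hn : n ∈ digitKernel p d S s a) (j : Fin d) : n j ≤ M / p ^ a := by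
  rw [Nat.le_div_iff_mul_le (pow_pos hp a), mul_comm]
  exact (Nat.le_add_right _ _).trans (hM _ hn j)

/-- If the largest coordinate `s i` of `S` has at least `L` base-`p` digits, then `S` has
`p`-complexity at least `L + 2`. -/
theorem add_two_le_pComplexity {p d L : ℕ} (hp : 1 < p) {S : Set (Fin d → ℕ)}
    (hfin : (pKernel p d S).Finite) {s : Fin d → ℕ} (hs : s ∈ S) (i : Fin d)
    (hmax : ∀ t ∈ S, ∀ j, t j ≤ s i) (hL : ∀ a < L, p ^ a ≤ s i) :
    L + 2 ≤ pComplexity p d S := by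
  have hp0 : 0 < p := by omega
  have hne : ∀ a b, a < b → b ≤ L → digitKernel p d S s a ≠ digitKernel p d S s b := by
    intro a b hab hb h
    have hle : s i / p ^ a ≤ s i / p ^ b :=
      le_div_of_mem_digitKernel hp0 hmax (h ▸ div_mem_digitKernel p hs a) i
    have hpos : 0 < s i / p ^ a := Nat.div_pos (hL a (by omega)) (pow_pos hp0 a)
    have hle' : s i / p ^ b ≤ s i / p ^ (a + 1) :=
      Nat.div_le_div_left (Nat.pow_le_pow_right hp0 hab) (pow_pos hp0 _)
    rw [pow_succ, ← Nat.div_div_eq_div_mul] at hle'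
    have := Nat.div_lt_self hpos hp
    omega
  have hinj : Set.InjOn (digitKernel p d S s) (Finset.range (L + 1) : Set ℕ) := by
    intro a ha b hb h
    simp only [Finset.coe_range, Set.mem_Iio] at ha hb
    rcases lt_trichotomy a b with hab | hab | hab
    · exact absurd h (hne a b hab (by omega))
    · exact hab
    · exact absurd h.symm (hne b a hab (by omega))
  have hcard := hinj.ncard_image
  rw [Set.ncard_coe_finset, Finset.card_range] at hcard
  have hempty : ∅ ∉ digitKernel p d S s '' (Finset.range (L + 1) : Set ℕ) := by
    rintro ⟨a, -, ha⟩
    exact (ha ▸ div_mem_digitKernel p hs a : _ ∈ (∅ : Set (Fin d → ℕ)))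
  have hins := Set.ncard_insert_of_notMem hempty ((Finset.finite_toSet _).image _)
  rw [hcard] at hins
  rw [pComplexity, show L + 2 = L + 1 + 1 from rfl, ← hins]
  refine Set.ncard_le_ncard (Set.insert_subset (empty_mem_pKernel hp i hmax) ?_) hfin
  rintro _ ⟨a, -, rfl⟩
  exact digitKernel_mem_pKernel hp0 S s a

/-- every element `s` of a finite `p`-automatic set `S ⊆ ℕ^d`
satisfies `‖s‖ = max_i s_i ≤ p^(comp_p(S) - 2)` (the bound read as a rational
number, with integer exponent). -/
theorem finite_automatic_set_elements_small
    (p : ℕ) (hp : p.Prime) (d : ℕ) (hd : 0 < d)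
    (S : Set (Fin d → ℕ)) (hSfin : S.Finite)
    (hfin : (pKernel p d S).Finite) :
    ∀ s ∈ S, ∀ i : Fin d,
      (s i : ℚ) ≤ (p : ℚ) ^ ((pComplexity p d S : ℤ) - 2) := by
  intro s hs i
  obtain ⟨⟨t, j⟩, ⟨ht, -⟩, hmax⟩ := Set.exists_max_image (S ×ˢ (Set.univ : Set (Fin d)))
    (fun x => x.1 x.2) (hSfin.prod Set.finite_univ) ⟨(s, i), hs, Set.mem_univ i⟩
  have hmax' : ∀ u ∈ S, ∀ k, u k ≤ t j := fun u hu k => hmax (u, k) ⟨hu, Set.mem_univ k⟩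
  have hex : ∃ L, t j < p ^ L := ⟨t j, Nat.lt_pow_self hp.one_lt⟩
  have hcomp := add_two_le_pComplexity hp.one_lt hfin ht j hmax'
    fun a ha => not_lt.mp (Nat.find_min hex ha)
  have hlt := Nat.find_spec hex
  calc (s i : ℚ) ≤ (p : ℚ) ^ Nat.find hex := by
        exact_mod_cast (hmax' s hs i).trans hlt.le
    _ = (p : ℚ) ^ (Nat.find hex : ℤ) := (zpow_natCast _ _).symm
    _ ≤ (p : ℚ) ^ ((pComplexity p d S : ℤ) - 2) :=
        zpow_le_zpow_right₀ (by exact_mod_cast hp.one_le) (by omega)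
end

section
/- Let K be a field, d and s positive integers, and r a natural number. Let V_0, V_1, …, V_s be s+1 vectors in K[t_1,…,t_d]^s such that every coordinate of every V_i is a polynomial of total degree at most r. Then there exist polynomials Q_0, Q_1, …, Q_s ∈ K[t_1,…,t_d], each of total degree at most r·s, not all zero, such that Σ_{i=0}^s Q_i V_i = 0 in K[t_1,…,t_d]^s. -/
theorem MvPolynomial.totalDegree_det_le {σ R n : Type*} [CommRing R] [Fintype n] [DecidableEq n]
    {r : ℕ} (A : Matrix n n (MvPolynomial σ R)) (hA : ∀ i j, (A i j).totalDegree ≤ r) :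
    A.det.totalDegree ≤ r * Fintype.card n := by
  rw [Matrix.det_apply]
  refine MvPolynomial.totalDegree_finsetSum_le fun τ _ => ?_
  have hprod : (∏ i, A (τ i) i).totalDegree ≤ r * Fintype.card n := by
    refine (MvPolynomial.totalDegree_finsetProd _ _).trans ?_
    refine (Finset.sum_le_card_nsmul _ _ r fun i _ => hA _ _).trans ?_
    simp [mul_comm]
  rcases Int.units_eq_one_or (Equiv.Perm.sign τ) with h | h <;> simpa [h] using hprod

/-- Either some choice of coordinates gives a nonvanishing maximal minor, or the vectors satisfy
a nontrivial relation whose coefficients have controlled degree. -/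
theorem MvPolynomial.exists_minor_ne_zero_or_exists_relation {σ R ι : Type*} [CommRing R]
    [Nontrivial R] {r s : ℕ} (n : ℕ) (hn : n ≤ s + 1) (V : Fin n → ι → MvPolynomial σ R)
    (hV : ∀ i j, (V i j).totalDegree ≤ r) :
    (∃ c : Fin n → ι, (Matrix.of fun i k => V i (c k)).det ≠ 0) ∨
      ∃ Q : Fin n → MvPolynomial σ R, (∀ i, (Q i).totalDegree ≤ r * s) ∧ (∃ i, Q i ≠ 0) ∧
        ∀ j, ∑ i, Q i * V i j = 0 := by
  induction n with
  | zero => exact Or.inl ⟨Fin.elim0, by simp⟩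
  | succ n ih =>
    rcases ih (by lia) (fun i => V i.succ) (fun i j => hV _ _) with ⟨c, hc⟩ | ⟨Q, hQ, ⟨i, hi⟩, h⟩
    · by_cases hdet : ∃ j, (Matrix.of fun i k => V i (Fin.cons (α := fun _ => ι) j c k)).det ≠ 0
      · obtain ⟨j, hj⟩ := hdet
        exact Or.inl ⟨Fin.cons j c, hj⟩
      · push Not at hdet
        refine Or.inr ⟨fun i => (-1) ^ (i : ℕ) *
          (Matrix.of fun l k => V (i.succAbove l) (c k)).det, fun i => ?_, ⟨0, ?_⟩, fun j => ?_⟩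
        · have hminor := MvPolynomial.totalDegree_det_le
            (Matrix.of fun l k => V (i.succAbove l) (c k)) (fun _ _ => hV _ _)
          rw [Fintype.card_fin] at hminor
          have hle := hminor.trans (Nat.mul_le_mul_left r (show n ≤ s by lia))
          rcases neg_one_pow_eq_or (MvPolynomial σ R) (i : ℕ) with h | h <;> simpa [h] using hle
        · simpa using hc
        · have hj := hdet j
          rw [Matrix.det_succ_column_zero] at hj
          rw [← hj]
          refine Finset.sum_congr rfl fun i _ => ?_
          rw [mul_right_comm]
          rfl
    · refine Or.inr ⟨Fin.cons 0 Q, Fin.cases (by simp) (by simpa using hQ), ⟨i.succ, by simpa⟩,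
        fun j => ?_⟩
      simpa [Fin.sum_univ_succ] using h j

/-- given `s + 1` vectors `V_0,…,V_s` in `K[t_1,…,t_d]^s` whose
coordinates all have total degree at most `r`, there is a nontrivial linear
relation `Σ Q_i V_i = 0` with polynomials `Q_i` of total degree at most `r·s`. -/
theorem polynomial_vectors_linear_relation
    (K : Type*) [Field K]
    (d s : ℕ) (hd : 0 < d) (hs : 0 < s) (r : ℕ)
    (V : Fin (s + 1) → Fin s → MvPolynomial (Fin d) K)
    (hdeg : ∀ i j, (V i j).totalDegree ≤ r) :
    ∃ Q : Fin (s + 1) → MvPolynomial (Fin d) K,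
      (∀ i, (Q i).totalDegree ≤ r * s) ∧ (∃ i, Q i ≠ 0) ∧
      ∀ j : Fin s, ∑ i : Fin (s + 1), Q i * V i j = 0 := by
  rcases MvPolynomial.exists_minor_ne_zero_or_exists_relation (s + 1) le_rfl V hdeg with
    ⟨c, hc⟩ | h
  · obtain ⟨k, l, hkl, hcl⟩ := Fintype.exists_ne_map_eq_of_card_lt c (by simp)
    exact absurd (Matrix.det_zero_of_column_eq hkl fun i => by simp [hcl]) hc
  · exact h
end
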